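/- arXiv:1606.08321 — 2 statements merged into one kernel-verified Lean document; each statement's English description precedes it below -/
import Mathlib

section
/- Let (X_i)_{i≥1} be identically distributed nonnegative random variables such that X₁ is regularly varying with index α > 0 and the family is uniformly asymptotically independent. Let (a_{i,j})_{i,j≥1} be a doubly indexed family of nonnegative random variables independent of (X_i), and let N be a positive integer-valued random variable, independent of (X_i) and of (a_{i,j}), with E[N^{2+α+ε}] < ∞ for some ε > 0. Let ‖·‖ be a norm on the space of finitely supported real sequences satisfying sup_i |u_i| ≤ ‖u‖ ≤ ∑_i |u_i|; write A(N) = (a_{i,j})_{1≤i,j≤N} and assume E[‖A(N)‖^{α+ε} N^{1+α+ε}] < ∞ for some ε > 0, where ‖A(N)‖ is the induced operator norm. Define C(N) to be the finitely supported sequence with C_i = ∑_{j=1}^N a_{i,j} X_j for i ≤ N and C_i = 0 for i > N. Then lim_{x→∞} P(‖C(N)‖ > x) / P(X₁ > x) = E[ ∑_{k=1}^N ‖A_k(N)‖^α ], where A_k(N) = (a_{1,k},…,a_{N,k},0,0,…) is the k-th column of A(N). -/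
open MeasureTheory ProbabilityTheory Filter

/-- The product of the `n × n` upper-left corner of the doubly indexed array `a` (indexed from `1`)
with the sequence `u` (`0`-based: coordinate `j - 1` of `u` is the `j`-th entry of the vector),
viewed as a finitely supported sequence: coordinate `i` (`0`-based) is
`∑_{j=1}^n a (i+1) j * u (j-1)` for `i + 1 ≤ n` and `0` otherwise. -/
noncomputable def matVecSeq (a : ℕ → ℕ → ℝ) (n : ℕ) (u : ℕ → ℝ) : ℕ → ℝ :=
  fun i => if i + 1 ≤ n then ∑ j ∈ Finset.Icc 1 n, a (i + 1) j * u (j - 1) else 0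

/-- The operator norm of `u ↦ A(n) u` induced by the sequence norm `nn`, the supremum being taken
over sequences supported on the first `n` coordinates with `nn u ≤ 1`. -/
noncomputable def seqOpNorm (nn : (ℕ → ℝ) → ℝ) (a : ℕ → ℕ → ℝ) (n : ℕ) : ℝ :=
  ⨆ u : {u : ℕ → ℝ // nn u ≤ 1 ∧ ∀ i, n ≤ i → u i = 0},
    nn (matVecSeq a n (u : ℕ → ℝ))

/-- The `k`-th column of the `n × n` upper-left corner of `a`, as a finitely supported sequence. -/
noncomputable def colSeq (a : ℕ → ℕ → ℝ) (n k : ℕ) : ℕ → ℝ :=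
  fun i => if i + 1 ≤ n then a (i + 1) k else 0


lemma rlb_potter (F : ℝ → ℝ) (hanti : Antitone F) (hpos : ∀ x, 0 < F x) (h1 : ∀ x, F x ≤ 1)
    (α p : ℝ) (hp : α < p) (hα : 0 < α)
    (hRV : Tendsto (fun x => F ((1/2) * x) / F x) atTop (nhds ((1/2 : ℝ) ^ (-α)))) :
    ∃ K x0 : ℝ, 0 < K ∧ 0 < x0 ∧ ∀ x, x0 ≤ x → ∀ t, 0 < t → F (x / t) ≤ K * (1 + t ^ p) * F x := by
  have hlt : ((1/2 : ℝ) ^ (-α)) < 2 ^ p := by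
    rw [one_div, Real.inv_rpow (by norm_num), Real.rpow_neg (by norm_num), inv_inv]
    exact Real.rpow_lt_rpow_of_exponent_lt (by norm_num) hp
  have hev := (hRV.eventually (gt_mem_nhds hlt)).and (eventually_ge_atTop (1:ℝ))
  obtain ⟨x0, hx0⟩ := eventually_atTop.1 hev
  have h2p : (1:ℝ) ≤ 2 ^ p := Real.one_le_rpow (by norm_num) (by linarith)
  have hx0pos : 0 < x0 := by linarith [(hx0 x0 le_rfl).2]
  have step : ∀ x, x0 ≤ x → F (x / 2) ≤ 2 ^ p * F x := by
    intro x hx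
    have := (hx0 x hx).1
    rw [div_lt_iff₀ (hpos x)] at this
    have e : x / 2 = 1 / 2 * x := by ring
    rw [e]; exact this.le
  set K := 1 / F x0 with hK
  have hK1 : 1 ≤ K := by rw [hK, le_div_iff₀ (hpos _)]; simpa using h1 x0
  have hKF : K * F x0 = 1 := by rw [hK]; field_simp [(hpos x0).ne']
  have ind : ∀ m : ℕ, ∀ x, x0 ≤ x → F (x / 2 ^ m) ≤ K * (2 ^ p) ^ m * F x := by
    intro m
    induction m with
    | zero => intro x hx; simp; nlinarith [hpos x]
    | succ m ih =>
      intro x hx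
      have hq : (1:ℝ) ≤ (2 ^ p) ^ m := one_le_pow₀ h2p
      by_cases hc : x0 ≤ x / 2
      · have e : x / 2 ^ (m+1) = (x / 2) / 2 ^ m := by rw [pow_succ]; field_simp
        rw [e]
        calc _ ≤ K * (2 ^ p) ^ m * F (x/2) := ih _ hc
          _ ≤ K * (2 ^ p) ^ m * (2 ^ p * F x) := by gcongr; exact step x hx
          _ = _ := by ring
      · push Not at hc
        calc F (x / 2 ^ (m+1)) ≤ 1 := h1 _
          _ = K * F x0 := hKF.symm
          _ ≤ K * F (x/2) := by gcongr; exact hanti hc.le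
          _ ≤ K * (2 ^ p * F x) := by gcongr; exact step x hx
          _ ≤ K * ((2 ^ p) ^ m * (2 ^ p * F x)) := by
              refine mul_le_mul_of_nonneg_left ?_ (by linarith)
              exact le_mul_of_one_le_left (mul_nonneg (by linarith) (hpos x).le) hq
          _ = _ := by ring
  refine ⟨K * 2 ^ p, x0, by positivity, hx0pos, fun x hx t ht => ?_⟩
  have hxp : 0 < x := by linarith
  have htp : 0 < t ^ p := Real.rpow_pos_of_pos ht p
  rcases le_total t 1 with h | h
  · have : F (x / t) ≤ F x := hanti (by rw [le_div_iff₀ ht]; nlinarith)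
    have h3 : 1 ≤ K * 2 ^ p * (1 + t ^ p) := by
      have : 1 ≤ K * 2 ^ p := one_le_mul_of_one_le_of_one_le hK1 h2p
      nlinarith
    nlinarith [hpos x]
  · obtain ⟨m, hm1, hm2⟩ := exists_nat_pow_near h (by norm_num : (1:ℝ) < 2)
    calc F (x / t) ≤ F (x / 2 ^ (m+1)) := hanti (by gcongr)
      _ ≤ K * (2 ^ p) ^ (m+1) * F x := ind _ x hx
      _ = K * 2 ^ p * ((2:ℝ) ^ m) ^ p * F x := by
          rw [pow_succ, ← Real.rpow_natCast (2 ^ p), ← Real.rpow_mul (by norm_num), mul_comm p,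
            Real.rpow_mul (by norm_num), Real.rpow_natCast]; ring
      _ ≤ K * 2 ^ p * (1 + t ^ p) * F x := by
          have := (hpos x).le
          gcongr
          have : ((2:ℝ) ^ m) ^ p ≤ t ^ p := Real.rpow_le_rpow (by positivity) hm1 (by linarith)
          linarith

lemma rlb_tail {Ω : Type*} [MeasurableSpace Ω] (P : Measure Ω) (X : ℕ → Ω → ℝ)
    (hXid : ∀ i, 1 ≤ i → IdentDistrib (X i) (X 1) P P) (i : ℕ) (hi : 1 ≤ i) (y : ℝ) :
    P.real {ω | y < X i ω} = P.real {ω | y < X 1 ω} := by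
  have := (hXid i hi).measure_mem_eq (measurableSet_Ioi (a := y))
  simp only [measureReal_def]
  congr 1

lemma rlb_single {Ω : Type*} [MeasurableSpace Ω] (P : Measure Ω)
    (X : ℕ → Ω → ℝ) 
    (hXid : ∀ i, 1 ≤ i → IdentDistrib (X i) (X 1) P P)
    (α : ℝ) (hα : 0 < α)
    (hRV : ∀ t : ℝ, 0 < t →
      Tendsto (fun x => (P.real {ω | t * x < X 1 ω}) / (P.real {ω | x < X 1 ω}))
        atTop (nhds (t ^ (-α))))
    (i : ℕ) (hi : 1 ≤ i) (c s : ℝ) (hc : 0 ≤ c) (hs : 0 < s) :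
    Tendsto (fun x => P.real {ω | s * x < c * X i ω} / P.real {ω | x < X 1 ω}) atTop
      (nhds (c ^ α * s ^ (-α))) := by
  rcases hc.eq_or_lt with h | h
  · subst h
    rw [Real.zero_rpow hα.ne', zero_mul]
    refine tendsto_const_nhds.congr' ?_
    filter_upwards [eventually_gt_atTop 0] with x hx
    have : {ω | s * x < 0 * X i ω} = ∅ := by
      ext ω; simp; positivity
    rw [this]; simp
  · have e : (s / c) ^ (-α) = c ^ α * s ^ (-α) := by
      rw [Real.div_rpow hs.le h.le, Real.rpow_neg h.le, div_inv_eq_mul, mul_comm]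
    rw [← e]
    refine (hRV (s / c) (by positivity)).congr fun x => ?_
    rw [← rlb_tail P X hXid i hi]
    have hset : {ω | s / c * x < X i ω} = {ω | s * x < c * X i ω} := by
      ext ω
      have : s / c * x = s * x / c := by ring
      simp only [Set.mem_ofPred_eq]
      rw [this, div_lt_iff₀ h, mul_comm c]
    rw [hset]

lemma rlb_pair {Ω : Type*} [MeasurableSpace Ω] (P : Measure Ω) [IsProbabilityMeasure P]
    (X : ℕ → Ω → ℝ) (hXnonneg : ∀ i ω, 0 ≤ X i ω)
    (α : ℝ) 
    (hpos : ∀ x : ℝ, 0 < P.real {ω | x < X 1 ω})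
    (hRV : ∀ t : ℝ, 0 < t →
      Tendsto (fun x => (P.real {ω | t * x < X 1 ω}) / (P.real {ω | x < X 1 ω}))
        atTop (nhds (t ^ (-α))))
    (hUAI : ∀ ε : ℝ, 0 < ε → ∃ x₀ : ℝ, ∀ x ≥ x₀, ∀ i j : ℕ, 1 ≤ i → 1 ≤ j → i ≠ j →
      (P.real {ω | x < X i ω ∧ x < X j ω}) ≤ ε * (P.real {ω | x < X 1 ω}))
    (i j : ℕ) (hi : 1 ≤ i) (hj : 1 ≤ j) (hij : i ≠ j) (c d s : ℝ) (hs : 0 < s)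
    (hc : 0 ≤ c) :
    Tendsto (fun x => P.real {ω | s * x < c * X i ω ∧ s * x < d * X j ω}
      / P.real {ω | x < X 1 ω}) atTop (nhds 0) := by
  set m := max c d + 1
  have hm : 0 < m := by have := le_max_left c d; simp only [m]; linarith
  have hcm : c ≤ m := by have := le_max_left c d; simp only [m]; linarith
  have hdm : d ≤ m := by have := le_max_right c d; simp only [m]; linarith
  have h1 : Tendsto (fun y => P.real {ω | y < X i ω ∧ y < X j ω} / P.real {ω | y < X 1 ω})
      atTop (nhds 0) := by
    rw [Metric.tendsto_atTop]
    intro ε hε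
    obtain ⟨x0, hx0⟩ := hUAI (ε/2) (by positivity)
    refine ⟨x0, fun x hx => ?_⟩
    rw [Real.dist_eq, sub_zero, abs_of_nonneg (by positivity), div_lt_iff₀ (hpos x)]
    have := hx0 x hx i j hi hj hij
    nlinarith [hpos x]
  have h2 : Tendsto (fun x : ℝ => s / m * x) atTop atTop :=
    tendsto_id.const_mul_atTop (by positivity)
  have h3 := (h1.comp h2).mul (hRV (s / m) (by positivity))
  rw [zero_mul] at h3
  refine squeeze_zero (fun x => by positivity) (fun x => ?_) h3
  simp only [Function.comp]
  rw [div_mul_div_cancel₀ (hpos _).ne']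
  refine div_le_div_of_nonneg_right (measureReal_mono ?_) (hpos x).le
  have e : s / m * x = s * x / m := by ring
  intro ω hω
  simp only [Set.mem_ofPred_eq] at hω ⊢
  rw [e, div_lt_iff₀ hm, div_lt_iff₀ hm]
  have := hXnonneg i ω
  have := hXnonneg j ω
  exact ⟨by nlinarith [hω.1], by nlinarith [hω.2]⟩

lemma rlb_pointwise {Ω : Type*} [MeasurableSpace Ω] (P : Measure Ω) [IsProbabilityMeasure P]
    (X : ℕ → Ω → ℝ) (hXmeas : ∀ i, Measurable (X i)) (hXnonneg : ∀ i ω, 0 ≤ X i ω)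
    (hXid : ∀ i, 1 ≤ i → IdentDistrib (X i) (X 1) P P)
    (α : ℝ) (hα : 0 < α)
    (hpos : ∀ x : ℝ, 0 < P.real {ω | x < X 1 ω})
    (hRV : ∀ t : ℝ, 0 < t →
      Tendsto (fun x => (P.real {ω | t * x < X 1 ω}) / (P.real {ω | x < X 1 ω}))
        atTop (nhds (t ^ (-α))))
    (hUAI : ∀ ε : ℝ, 0 < ε → ∃ x₀ : ℝ, ∀ x ≥ x₀, ∀ i j : ℕ, 1 ≤ i → 1 ≤ j → i ≠ j →
      (P.real {ω | x < X i ω ∧ x < X j ω}) ≤ ε * (P.real {ω | x < X 1 ω}))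
    (n : ℕ) (hn : 1 ≤ n) (c : ℕ → ℝ) (hc : ∀ k, 0 ≤ c k) (Z : Ω → ℝ)
    (hZ1 : ∀ ω, Z ω ≤ ∑ k ∈ Finset.Icc 1 n, c k * X k ω)
    (hZ2 : ∀ ω, ∀ i ∈ Finset.Icc 1 n,
      c i * X i ω - ∑ k ∈ (Finset.Icc 1 n).erase i, c k * X k ω ≤ Z ω) :
    Tendsto (fun x => P.real {ω | x < Z ω} / P.real {ω | x < X 1 ω}) atTop
      (nhds (∑ k ∈ Finset.Icc 1 n, c k ^ α)) := by
  have hn' : (0:ℝ) < n := by exact_mod_cast hn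
  set I := Finset.Icc 1 n with hI
  set L := ∑ k ∈ I, c k ^ α with hL
  have hcard : (I.card : ℝ) = n := by simp [hI]
  have hI1 : ∀ i ∈ I, 1 ≤ i := fun i hi => (Finset.mem_Icc.1 hi).1
  -- pair sums
  have hpairs : ∀ s, 0 < s → Tendsto (fun x => (∑ i ∈ I, ∑ j ∈ I.erase i,
      P.real {ω | s * x < c i * X i ω ∧ s * x < c j * X j ω})
        / P.real {ω | x < X 1 ω}) atTop (nhds 0) := by
    intro s hs
    have : Tendsto (fun x => (∑ i ∈ I, ∑ j ∈ I.erase i,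
      P.real {ω | s * x < c i * X i ω ∧ s * x < c j * X j ω}
        / P.real {ω | x < X 1 ω})) atTop (nhds (∑ i ∈ I, ∑ j ∈ I.erase i, (0:ℝ))) := by
      refine tendsto_finsetSum _ fun i hi => tendsto_finsetSum _ fun j hj => ?_
      exact rlb_pair P X hXnonneg α hpos hRV hUAI i j (hI1 i hi)
        (hI1 j (Finset.mem_of_mem_erase hj)) (Finset.ne_of_mem_erase hj).symm _ _ s hs (hc i)
    simp only [Finset.sum_const_zero] at this
    refine this.congr fun x => ?_
    simp only [Finset.sum_div]
  have hsing : ∀ s, 0 < s → Tendsto (fun x => (∑ i ∈ I, P.real {ω | s * x < c i * X i ω})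
        / P.real {ω | x < X 1 ω}) atTop (nhds (L * s ^ (-α))) := by
    intro s hs
    rw [hL, Finset.sum_mul]
    have := tendsto_finsetSum I fun i hi =>
      rlb_single P X hXid α hα hRV i (hI1 i hi) (c i) s (hc i) hs
    refine this.congr fun x => ?_
    simp only [Finset.sum_div]
  have upper : ∀ δ, 0 < δ → δ < 1 → ∀ x, 0 < x → P.real {ω | x < Z ω} / P.real {ω | x < X 1 ω} ≤
      (∑ i ∈ I, P.real {ω | (1-δ) * x < c i * X i ω}) / P.real {ω | x < X 1 ω} +
      (∑ i ∈ I, ∑ j ∈ I.erase i,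
        P.real {ω | δ / n * x < c i * X i ω ∧ δ / n * x < c j * X j ω})
        / P.real {ω | x < X 1 ω} := by
    intro δ hδ hδ1 x hx
    rw [← add_div]
    have := hpos x
    gcongr
    have hsub : {ω | x < Z ω} ⊆ (⋃ i ∈ I, {ω | (1-δ) * x < c i * X i ω}) ∪
        (⋃ i ∈ I, ⋃ j ∈ I.erase i,
          {ω | δ / n * x < c i * X i ω ∧ δ / n * x < c j * X j ω}) := by
      intro ω hω
      by_contra hcon
      simp only [Set.mem_union, Set.mem_iUnion, Set.mem_ofPred_eq, not_or, not_exists, not_and,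
        not_lt, exists_prop] at hcon hω
      obtain ⟨h1, h2⟩ := hcon
      have hz := hZ1 ω
      have hden : 0 < δ / n * x := by positivity
      have hsmall : (n:ℝ) * (δ / n * x) = δ * x := by field_simp
      by_cases hex : ∃ i ∈ I, δ / n * x < c i * X i ω
      · obtain ⟨i, hi, hlt⟩ := hex
        have hr : ∑ k ∈ I.erase i, c k * X k ω ≤ n * (δ / n * x) := by
          calc _ ≤ (I.erase i).card • (δ / n * x) :=
                Finset.sum_le_card_nsmul _ _ _ fun j hj => h2 i hi j hj hlt
            _ ≤ I.card • (δ / n * x) := by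
                apply nsmul_le_nsmul_left hden.le
                exact Finset.card_le_card (Finset.erase_subset _ _)
            _ = _ := by rw [nsmul_eq_mul, hcard]
        rw [← Finset.add_sum_erase I _ hi] at hz
        have := h1 i hi
        linarith
      · push Not at hex
        have : ∑ k ∈ I, c k * X k ω ≤ n * (δ / n * x) := by
          calc _ ≤ I.card • (δ / n * x) :=
                Finset.sum_le_card_nsmul _ _ _ hex
            _ = _ := by rw [nsmul_eq_mul, hcard]
        nlinarith
    calc _ ≤ P.real _ := measureReal_mono hsub
      _ ≤ _ := measureReal_union_le _ _
      _ ≤ _ := by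
        gcongr
        · exact measureReal_biUnion_finset_le _ _
        · refine (measureReal_biUnion_finset_le _ _).trans ?_
          gcongr
          exact measureReal_biUnion_finset_le _ _
  have lower : ∀ δ, 0 < δ → ∀ x, 0 < x → 
      (∑ i ∈ I, P.real {ω | (1+δ) * x < c i * X i ω}) / P.real {ω | x < X 1 ω} -
      (∑ i ∈ I, ∑ j ∈ I.erase i,
        P.real {ω | δ / n * x < c i * X i ω ∧ δ / n * x < c j * X j ω})
        / P.real {ω | x < X 1 ω} ≤ P.real {ω | x < Z ω} / P.real {ω | x < X 1 ω} := by
    intro δ hδ x hx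
    rw [← sub_div]
    have := hpos x
    gcongr
    rw [sub_le_iff_le_add]
    have hden : 0 < δ / n * x := by positivity
    have hsmall : (n:ℝ) * (δ / n * x) = δ * x := by field_simp
    have hn1 : (1:ℝ) ≤ n := by exact_mod_cast hn
    have hDE : δ / n * x ≤ (1 + δ) * x := by nlinarith
    set E : ℕ → Set Ω := fun i => {ω | (1+δ) * x < c i * X i ω} ∩
      {ω | ∀ j ∈ I.erase i, c j * X j ω ≤ δ / n * x} with hE
    have hEm : ∀ i, MeasurableSet (E i) := by
      intro i
      refine (measurableSet_lt measurable_const ((hXmeas i).const_mul _)).inter ?_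
      have : {ω | ∀ j ∈ I.erase i, c j * X j ω ≤ δ / n * x} =
        ⋂ j ∈ I.erase i, {ω | c j * X j ω ≤ δ / n * x} := by ext; simp
      rw [this]
      exact Finset.measurableSet_biInter _ fun j _ =>
        measurableSet_le ((hXmeas j).const_mul _) measurable_const
    have hdisj : Set.PairwiseDisjoint (I : Set ℕ) E := by
      intro i hi j hj hij
      rw [Function.onFun, Set.disjoint_left]
      rintro ω ⟨h1, h2⟩ ⟨h3, h4⟩
      have := h2 j (Finset.mem_erase.2 ⟨hij.symm, hj⟩)
      simp only [Set.mem_ofPred_eq] at h3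
      linarith
    have hsumE : ∑ i ∈ I, P.real (E i) ≤ P.real {ω | x < Z ω} := by
      rw [← measureReal_biUnion_finset hdisj (fun i _ => hEm i)]
      apply measureReal_mono _
      intro ω hω
      simp only [Set.mem_iUnion] at hω
      obtain ⟨i, hi, h1, h2⟩ := hω
      simp only [Set.mem_ofPred_eq] at h1 h2 ⊢
      have hr : ∑ k ∈ I.erase i, c k * X k ω ≤ n * (δ / n * x) := by
          calc _ ≤ (I.erase i).card • (δ / n * x) :=
                Finset.sum_le_card_nsmul _ _ _ fun j hj => h2 j hj
            _ ≤ I.card • (δ / n * x) := by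
                apply nsmul_le_nsmul_left hden.le
                exact Finset.card_le_card (Finset.erase_subset _ _)
            _ = _ := by rw [nsmul_eq_mul, hcard]
      have := hZ2 ω i hi
      linarith
    calc ∑ i ∈ I, P.real {ω | (1+δ) * x < c i * X i ω} ≤ ∑ i ∈ I, (P.real (E i) +
          ∑ j ∈ I.erase i,
            P.real {ω | δ / n * x < c i * X i ω ∧ δ / n * x < c j * X j ω}) := by
          refine Finset.sum_le_sum fun i hi => ?_
          have hsub : {ω | (1+δ) * x < c i * X i ω} ⊆ E i ∪ ⋃ j ∈ I.erase i,
              {ω | δ / n * x < c i * X i ω ∧ δ / n * x < c j * X j ω} := by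
            intro ω hω
            by_cases h : ∀ j ∈ I.erase i, c j * X j ω ≤ δ / n * x
            · exact Or.inl ⟨hω, h⟩
            · right
              push Not at h
              obtain ⟨j, hj, hlt⟩ := h
              simp only [Set.mem_iUnion]
              exact ⟨j, hj, hDE.trans_lt hω, hlt⟩
          refine (measureReal_mono hsub).trans ((measureReal_union_le _ _).trans ?_)
          gcongr
          exact measureReal_biUnion_finset_le _ _
      _ = ∑ i ∈ I, P.real (E i) + _ := Finset.sum_add_distrib
      _ ≤ _ := by gcongr
  have hcont : ∀ (σ : ℝ), Tendsto (fun δ : ℝ => L * (1 + σ * δ) ^ (-α)) (nhdsWithin 0 (Set.Ioi 0))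
      (nhds L) := by
    intro σ
    have : ContinuousAt (fun δ : ℝ => L * (1 + σ * δ) ^ (-α)) 0 := by
      refine continuousAt_const.mul (ContinuousAt.rpow_const (by fun_prop) (Or.inl (by simp)))
    have h := this.tendsto
    simp at h
    exact h.mono_left nhdsWithin_le_nhds
  have hpos' : ∀ᶠ δ : ℝ in nhdsWithin 0 (Set.Ioi 0), 0 < δ ∧ δ < 1 := by
    filter_upwards [Ioo_mem_nhdsGT (show (0:ℝ) < 1 by norm_num)] with δ hδ using hδ
  rw [tendsto_order]
  constructor
  · intro b hb
    obtain ⟨δ, h1, h2, h3⟩ := (((hcont 1).eventually (lt_mem_nhds hb)).and hpos').exists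
    rw [one_mul] at h1
    have := (hsing (1+δ) (by linarith)).sub (hpairs (δ/n) (by positivity))
    rw [sub_zero] at this
    filter_upwards [this.eventually (lt_mem_nhds h1), eventually_gt_atTop 0] with x hx hx0
    exact hx.trans_le (lower δ h2 x hx0)
  · intro b hb
    obtain ⟨δ, h1, h2, h3⟩ := (((hcont (-1)).eventually (gt_mem_nhds hb)).and hpos').exists
    rw [neg_one_mul, ← sub_eq_add_neg] at h1
    have := (hsing (1-δ) (by linarith)).add (hpairs (δ/n) (by positivity))
    rw [add_zero] at this
    filter_upwards [this.eventually (gt_mem_nhds h1), eventually_gt_atTop 0] with x hx hx0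
    exact (upper δ h2 h3 x hx0).trans_lt hx

lemma rlb_supp (u : ℕ → ℝ) (n : ℕ) (h : ∀ i, n ≤ i → u i = 0) : (Function.support u).Finite := by
  refine (Set.finite_Iio n).subset fun i hi => ?_
  by_contra hc
  exact hi (h i (not_lt.1 hc))

lemma rlb_col_supp (b : ℕ → ℕ → ℝ) (n k : ℕ) : (Function.support (colSeq b n k)).Finite := by
  refine rlb_supp _ n fun i hi => ?_
  simp [colSeq, hi]

lemma rlb_matVec_supp (b : ℕ → ℕ → ℝ) (n : ℕ) (u : ℕ → ℝ) :
    ∀ i, n ≤ i → matVecSeq b n u i = 0 := by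
  intro i hi
  simp [matVecSeq, hi]

lemma rlb_matVec_eq (b : ℕ → ℕ → ℝ) (n : ℕ) (u : ℕ → ℝ) :
    matVecSeq b n u = ∑ k ∈ Finset.Icc 1 n, u (k - 1) • colSeq b n k := by
  ext i
  simp only [matVecSeq, colSeq, Finset.sum_apply, Pi.smul_apply, smul_eq_mul]
  split_ifs
  · exact Finset.sum_congr rfl fun _ _ => mul_comm _ _
  · simp

lemma rlb_sum_supp {ι : Type*} (s : Finset ι) (f : ι → ℕ → ℝ)
    (hf : ∀ k, (Function.support (f k)).Finite) : (Function.support (∑ k ∈ s, f k)).Finite := by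
  refine (s.finite_toSet.biUnion fun k _ => hf k).subset ?_
  intro i hi
  simp only [Function.mem_support, Finset.sum_apply] at hi
  obtain ⟨k, hk, h⟩ := Finset.exists_ne_zero_of_sum_ne_zero hi
  simp only [Set.mem_iUnion]
  exact ⟨k, hk, h⟩

lemma rlb_nn_sum (nn : (ℕ → ℝ) → ℝ)
    (hnn_tri : ∀ u v : ℕ → ℝ, (Function.support u).Finite → (Function.support v).Finite →
      nn (u + v) ≤ nn u + nn v)
    (hnn_smul : ∀ (c : ℝ) (u : ℕ → ℝ), (Function.support u).Finite →
      nn (c • u) = |c| * nn u) {ι : Type*} (s : Finset ι) (f : ι → ℕ → ℝ)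
    (hf : ∀ k, (Function.support (f k)).Finite) : nn (∑ k ∈ s, f k) ≤ ∑ k ∈ s, nn (f k) := by
  classical
  induction s using Finset.induction_on with
  | empty =>
    have := hnn_smul 0 0 (by simp)
    simp at this
    simp [this]
  | insert k s hk ih =>
    rw [Finset.sum_insert hk, Finset.sum_insert hk]
    have := hnn_tri _ _ (hf k) (rlb_sum_supp s f hf)
    linarith

lemma rlb_nn_meas (nn : (ℕ → ℝ) → ℝ)
    (hnn_tri : ∀ u v : ℕ → ℝ, (Function.support u).Finite → (Function.support v).Finite →
      nn (u + v) ≤ nn u + nn v)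
    (hnn_upper : ∀ u : ℕ → ℝ, (Function.support u).Finite → nn u ≤ ∑' i, |u i|)
    {β : Type*} [MeasurableSpace β] (n : ℕ) (f : β → ℕ → ℝ) (hf : ∀ i, Measurable fun y => f y i)
    (h0 : ∀ y i, n ≤ i → f y i = 0) : Measurable fun y => nn (f y) := by
  let e : (Fin n → ℝ) → ℕ → ℝ := fun v i => if h : i < n then v ⟨i, h⟩ else 0
  have he0 : ∀ v i, n ≤ i → e v i = 0 := fun v i hi => by simp [e, hi]
  have hes : ∀ v, (Function.support (e v)).Finite := fun v => rlb_supp _ n (he0 v)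
  have heu : ∀ v, nn (e v) ≤ ∑ i, |v i| := by
    intro v
    refine (hnn_upper _ (hes v)).trans ?_
    rw [tsum_eq_sum (s := Finset.range n)
      (fun i hi => by rw [he0 v i (by simpa using hi), abs_zero]), Finset.sum_range]
    refine Finset.sum_le_sum fun i _ => ?_
    simp [e]
  have head : ∀ v w, e v = e w + e (v - w) := by
    intro v w
    ext i
    simp only [e, Pi.add_apply, Pi.sub_apply]
    split_ifs <;> simp
  have hdiff : ∀ v w, nn (e v) - nn (e w) ≤ ∑ i, |v i - w i| := by
    intro v w
    have h1 := hnn_tri _ _ (hes w) (hes (v - w))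
    rw [← head] at h1
    have h2 := heu (v - w)
    simp only [Pi.sub_apply] at h2
    linarith
  have hcont : Continuous fun v => nn (e v) := by
    rw [continuous_iff_continuousAt]
    intro w
    rw [ContinuousAt, tendsto_iff_dist_tendsto_zero]
    have hc : Tendsto (fun v : Fin n → ℝ => ∑ i, |v i - w i|) (nhds w) (nhds 0) := by
      have : Continuous fun v : Fin n → ℝ => ∑ i, |v i - w i| := by fun_prop
      have := this.tendsto w
      simpa using this
    refine squeeze_zero (fun _ => dist_nonneg) (fun v => ?_) hc
    rw [Real.dist_eq, abs_le]
    have h1 := hdiff v w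
    have h2 := hdiff w v
    simp only [abs_sub_comm (w _)] at h2
    exact ⟨by linarith, h1⟩
  have hfe : ∀ y, f y = e (fun i => f y i) := by
    intro y
    ext i
    simp only [e]
    split_ifs with h
    · rfl
    · exact h0 y i (not_lt.1 h)
  have : (fun y => nn (f y)) = (fun v => nn (e v)) ∘ fun y => fun i : Fin n => f y i := by
    ext y
    simp only [Function.comp]
    rw [← hfe]
  rw [this]
  exact hcont.measurable.comp (measurable_pi_lambda _ fun i => hf i)

lemma rlb_col_le (nn : (ℕ → ℝ) → ℝ)
    (hnn_lower : ∀ u : ℕ → ℝ, (Function.support u).Finite → ∀ i, |u i| ≤ nn u)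
    (hnn_upper : ∀ u : ℕ → ℝ, (Function.support u).Finite → nn u ≤ ∑' i, |u i|)
    (b : ℕ → ℕ → ℝ) (n k : ℕ) (hk : k ∈ Finset.Icc 1 n) :
    nn (colSeq b n k) ≤ seqOpNorm nn b n := by
  have hk' := Finset.mem_Icc.1 hk
  have hbdd : BddAbove (Set.range fun u : {u : ℕ → ℝ // nn u ≤ 1 ∧ ∀ i, n ≤ i → u i = 0} =>
      nn (matVecSeq b n (u : ℕ → ℝ))) := by
    refine ⟨∑ i ∈ Finset.range n, ∑ j ∈ Finset.Icc 1 n, |b (i+1) j|, ?_⟩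
    rintro _ ⟨⟨u, hu1, hu2⟩, rfl⟩
    simp only
    refine (hnn_upper _ (rlb_supp _ n (rlb_matVec_supp b n u))).trans ?_
    rw [tsum_eq_sum (s := Finset.range n)
      (fun i hi => by rw [rlb_matVec_supp b n u i (by simpa using hi), abs_zero])]
    refine Finset.sum_le_sum fun i hi => ?_
    have : i + 1 ≤ n := by simpa using hi
    simp only [matVecSeq, if_pos this]
    refine (Finset.abs_sum_le_sum_abs _ _).trans (Finset.sum_le_sum fun j _ => ?_)
    rw [abs_mul]
    have := (hnn_lower u (rlb_supp _ n hu2) (j-1)).trans hu1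
    exact mul_le_of_le_one_right (abs_nonneg _) this
  let u : ℕ → ℝ := Pi.single (k-1) 1
  have hu0 : ∀ i, n ≤ i → u i = 0 := by
    intro i hi
    simp only [u]
    rw [Pi.single_apply, if_neg (by omega)]
  have hu1 : nn u ≤ 1 := by
    refine (hnn_upper u (rlb_supp _ n hu0)).trans ?_
    rw [tsum_eq_single (k-1)]
    · simp [u]
    · intro i hi
      simp [u, Pi.single_apply, hi]
  have := le_ciSup hbdd ⟨u, hu1, hu0⟩
  refine le_trans (le_of_eq ?_) this
  simp only
  congr 1
  rw [rlb_matVec_eq, Finset.sum_eq_single k]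
  · simp [u]
  · intro j hj hjk
    have := Finset.mem_Icc.1 hj
    simp only [u]
    rw [Pi.single_apply, if_neg (by omega), zero_smul]
  · intro h; exact absurd hk h

lemma rlb_dom {Ω : Type*} [MeasurableSpace Ω] (P : Measure Ω) [IsProbabilityMeasure P]
    (X : ℕ → Ω → ℝ)
    (hXid : ∀ i, 1 ≤ i → IdentDistrib (X i) (X 1) P P) (K p x0 : ℝ) (hK : 0 < K)
    (hx0 : 0 < x0)
    (hpot : ∀ x, x0 ≤ x → ∀ t, 0 < t →
      P.real {ω | x / t < X 1 ω} ≤ K * (1 + t ^ p) * P.real {ω | x < X 1 ω})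
    (n : ℕ) (hn : 1 ≤ n) (c : ℕ → ℝ) (hc : ∀ k, 0 ≤ c k) (Z : Ω → ℝ)
    (hZ1 : ∀ ω, Z ω ≤ ∑ k ∈ Finset.Icc 1 n, c k * X k ω) (x : ℝ) (hx : x0 ≤ x) :
    P.real {ω | x < Z ω} ≤
      (∑ k ∈ Finset.Icc 1 n, K * (1 + (c k * n) ^ p)) * P.real {ω | x < X 1 ω} := by
  have hn' : (0:ℝ) < n := by exact_mod_cast hn
  have hsub : {ω | x < Z ω} ⊆ ⋃ k ∈ Finset.Icc 1 n, {ω | x / n < c k * X k ω} := by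
    intro ω hω
    by_contra hcon
    simp only [Set.mem_iUnion, Set.mem_ofPred_eq, not_exists, not_lt, exists_prop, not_and]
      at hcon hω
    have := Finset.sum_le_card_nsmul _ _ _ hcon
    rw [nsmul_eq_mul, Nat.card_Icc, Nat.add_sub_cancel, mul_div_cancel₀ _ hn'.ne'] at this
    linarith [hZ1 ω]
  refine (measureReal_mono hsub (measure_ne_top _ _)).trans ((measureReal_biUnion_finset_le _ _).trans ?_)
  rw [Finset.sum_mul]
  refine Finset.sum_le_sum fun k hk => ?_
  rcases (hc k).eq_or_lt with h | h
  · have : {ω | x / n < c k * X k ω} = ∅ := by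
      ext ω
      simp only [← h, zero_mul, Set.mem_ofPred_eq, Set.mem_empty_iff_false, iff_false, not_lt]
      have : 0 < x := by linarith
      positivity
    rw [this, measureReal_empty]
    have : 0 ≤ (c k * n) ^ p := Real.rpow_nonneg (by have := hc k; positivity) _
    positivity
  · have : {ω | x / n < c k * X k ω} = {ω | x / (c k * n) < X k ω} := by
      ext ω
      simp only [Set.mem_ofPred_eq]
      rw [div_lt_iff₀ hn', div_lt_iff₀ (by positivity)]
      ring_nf
    rw [this, rlb_tail P X hXid k (Finset.mem_Icc.1 hk).1]
    exact hpot x hx _ (by positivity)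

lemma rlb_fubini {Ω β γ : Type*} [MeasurableSpace Ω] [MeasurableSpace β] [MeasurableSpace γ]
    (P : Measure Ω) [IsProbabilityMeasure P] (Y : Ω → β) (Z : Ω → γ) (hY : Measurable Y)
    (hZ : Measurable Z) (h : IndepFun Y Z P) (T : Set (β × γ)) (hT : MeasurableSet T) :
    P.real {ω | (Y ω, Z ω) ∈ T} = ∫ ω, P.real {ω' | (Y ω, Z ω') ∈ T} ∂P ∧
    Measurable fun ω => P.real {ω' | (Y ω, Z ω') ∈ T} := by
  have : IsProbabilityMeasure (P.map Z) := Measure.isProbabilityMeasure_map hZ.aemeasurable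
  have e : ∀ y, P {ω' | (y, Z ω') ∈ T} = (P.map Z) (Prod.mk y ⁻¹' T) := by
    intro y
    rw [Measure.map_apply hZ (measurable_prodMk_left hT)]
    rfl
  have hm : Measurable fun y => P {ω' | (y, Z ω') ∈ T} := by
    simp only [e]
    exact measurable_measure_prodMk_left hT
  refine ⟨?_, (hm.comp hY).ennreal_toReal⟩
  have hmeq := (indepFun_iff_map_prod_eq_prod_map_map hY.aemeasurable hZ.aemeasurable).1 h
  simp only [measureReal_def]
  have hm' : Measurable fun ω => P {ω' | (Y ω, Z ω') ∈ T} := hm.comp hY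
  rw [integral_toReal hm'.aemeasurable (ae_of_all _ fun _ => measure_lt_top _ _)]
  congr 1
  have h1 : P {ω | (Y ω, Z ω) ∈ T} = P.map (fun ω => (Y ω, Z ω)) T := by
    rw [Measure.map_apply (hY.prodMk hZ) hT]; rfl
  rw [h1, hmeq, Measure.prod_apply hT, lintegral_map (measurable_measure_prodMk_left hT) hY]
  simp only [e]

lemma rlb_indep {Ω β γ κ : Type*} [MeasurableSpace Ω] [MeasurableSpace β] [MeasurableSpace γ]
    [MeasurableSpace κ]
    (P : Measure Ω) [IsProbabilityMeasure P] (A : Ω → β) (Z : Ω → γ) (N : Ω → κ)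
    (hA : Measurable A) (hZ : Measurable Z) (hN : Measurable N) (h : IndepFun A Z P)
    (h' : IndepFun N (fun ω => (Z ω, A ω)) P) : IndepFun (fun ω => (A ω, N ω)) Z P := by
  have : IsProbabilityMeasure (P.map Z) := Measure.isProbabilityMeasure_map hZ.aemeasurable
  have hAN : Measurable fun ω => (A ω, N ω) := hA.prodMk hN
  have := Measure.isProbabilityMeasure_map (μ := P) (hAN.prodMk hZ).aemeasurable
  rw [indepFun_iff_map_prod_eq_prod_map_map hAN.aemeasurable hZ.aemeasurable,
    Measure.ext_prod₃_iff']
  intro s t u hs ht hu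
  rw [Measure.map_apply (hAN.prodMk hZ) ((hs.prod ht).prod hu), Measure.prod_prod,
    Measure.map_apply hAN (hs.prod ht), Measure.map_apply hZ hu]
  have h2 : IndepFun N A P := h'.comp measurable_id measurable_snd
  have e1 := h'.measure_inter_preimage_eq_mul _ _ ht (hu.prod hs)
  have e2 := h.measure_inter_preimage_eq_mul _ _ hs hu
  have e3 := h2.measure_inter_preimage_eq_mul _ _ ht hs
  have s1 : (fun ω => ((A ω, N ω), Z ω)) ⁻¹' ((s ×ˢ t) ×ˢ u) =
      N ⁻¹' t ∩ (fun ω => (Z ω, A ω)) ⁻¹' (u ×ˢ s) := by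
    ext ω; simp; tauto
  have s2 : (fun ω => (Z ω, A ω)) ⁻¹' (u ×ˢ s) = A ⁻¹' s ∩ Z ⁻¹' u := by
    ext ω; simp; tauto
  have s3 : (fun ω => (A ω, N ω)) ⁻¹' (s ×ˢ t) = N ⁻¹' t ∩ A ⁻¹' s := by
    ext ω; simp; tauto
  rw [s1, e1, s2, e2, s3, e3, mul_assoc]
set_option maxHeartbeats 1000000 in
/-- Breiman's lemma for random length sequences: with
`C(N) = A(N) X(N)`, i.e. `C i = ∑_{j=1}^N a i j * X j` for `1 ≤ i ≤ N` and `0` beyond,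
`P(nn (C(N)) > x) / P(X 1 > x) → E[∑_{k=1}^N nn (A_k(N)) ^ α]` as `x → ∞`. -/
theorem random_length_breiman
    {Ω : Type*} [MeasurableSpace Ω] (P : Measure Ω) [IsProbabilityMeasure P]
    (X : ℕ → Ω → ℝ) (hXmeas : ∀ i, Measurable (X i))
    (hXnonneg : ∀ i ω, 0 ≤ X i ω)
    (hXid : ∀ i, 1 ≤ i → IdentDistrib (X i) (X 1) P P)
    (α : ℝ) (hα : 0 < α)
    (hRVpos : ∀ x : ℝ, 0 < x → 0 < P {ω | x < X 1 ω})
    (hRV : ∀ t : ℝ, 0 < t →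
      Tendsto (fun x => (P {ω | t * x < X 1 ω}).toReal / (P {ω | x < X 1 ω}).toReal)
        atTop (nhds (t ^ (-α))))
    (hUAI : ∀ ε : ℝ, 0 < ε → ∃ x₀ : ℝ, ∀ x ≥ x₀, ∀ i j : ℕ, 1 ≤ i → 1 ≤ j → i ≠ j →
      (P {ω | x < X i ω ∧ x < X j ω}).toReal ≤ ε * (P {ω | x < X 1 ω}).toReal)
    (a : ℕ → ℕ → Ω → ℝ) (hameas : ∀ i j, Measurable fun ω => a i j ω)
    (hanonneg : ∀ i j ω, 0 ≤ a i j ω)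
    (haX_indep : IndepFun (fun ω => fun q : ℕ × ℕ => a q.1 q.2 ω)
      (fun ω => fun i : ℕ => X i ω) P)
    (N : Ω → ℕ) (hNmeas : Measurable N) (hNpos : ∀ ω, 1 ≤ N ω)
    (hN_indep : IndepFun N
      (fun ω => (fun i : ℕ => X i ω, fun q : ℕ × ℕ => a q.1 q.2 ω)) P)
    (hNmom : ∃ ε : ℝ, 0 < ε ∧
      ∫⁻ ω, ENNReal.ofReal ((N ω : ℝ) ^ ((2 : ℝ) + α + ε)) ∂P < ⊤)
    (nn : (ℕ → ℝ) → ℝ)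
    (hnn_tri : ∀ u v : ℕ → ℝ, (Function.support u).Finite → (Function.support v).Finite →
      nn (u + v) ≤ nn u + nn v)
    (hnn_smul : ∀ (c : ℝ) (u : ℕ → ℝ), (Function.support u).Finite →
      nn (c • u) = |c| * nn u)
    (hnn_zero : ∀ u : ℕ → ℝ, (Function.support u).Finite → nn u = 0 → u = 0)
    (hnn_lower : ∀ u : ℕ → ℝ, (Function.support u).Finite → ∀ i, |u i| ≤ nn u)
    (hnn_upper : ∀ u : ℕ → ℝ, (Function.support u).Finite → nn u ≤ ∑' i, |u i|)
    (hAmom : ∃ ε : ℝ, 0 < ε ∧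
      ∫⁻ ω, ENNReal.ofReal (seqOpNorm nn (fun i j => a i j ω) (N ω) ^ (α + ε)
        * (N ω : ℝ) ^ ((1 : ℝ) + α + ε)) ∂P < ⊤) :
    Tendsto (fun x =>
        (P {ω | x < nn (matVecSeq (fun i j => a i j ω) (N ω) (fun i => X (i + 1) ω))}).toReal
          / (P {ω | x < X 1 ω}).toReal)
      atTop
      (nhds (∫ ω, ∑ k ∈ Finset.Icc 1 (N ω),
        nn (colSeq (fun i j => a i j ω) (N ω) k) ^ α ∂P)) := by
  have hF0 : ∀ x : ℝ, 0 < P.real {ω | x < X 1 ω} := by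
    intro x
    have h1 : 0 < P {ω | max x 1 < X 1 ω} := hRVpos _ (by positivity)
    have h2 : P {ω | max x 1 < X 1 ω} ≤ P {ω | x < X 1 ω} :=
      measure_mono fun ω hω => (le_max_left x 1).trans_lt hω
    exact ENNReal.toReal_pos (h1.trans_le h2).ne' (measure_ne_top _ _)
  obtain ⟨ε, hε, hAint⟩ := hAmom
  obtain ⟨ε', hε', hNint⟩ := hNmom
  obtain ⟨K, x0, hK, hx0, hpot⟩ := rlb_potter (fun x => P.real {ω | x < X 1 ω})
    (fun x y hxy => measureReal_mono fun ω hω => hxy.trans_lt hω) hF0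
    (fun x => measureReal_le_one) α (α + ε) (by linarith) hα (hRV (1/2) (by norm_num))
  -- the norm facts
  have hnn0 : ∀ u : ℕ → ℝ, (Function.support u).Finite → 0 ≤ nn u := fun u hu =>
    (abs_nonneg _).trans (hnn_lower u hu 0)
  have hc0 : ∀ (b : ℕ → ℕ → ℝ) n k, 0 ≤ nn (colSeq b n k) := fun b n k =>
    hnn0 _ (rlb_col_supp b n k)
  have hsm : ∀ (b : ℕ → ℕ → ℝ) n k (r : ℝ), 
      (Function.support (r • colSeq b n k)).Finite := fun b n k r =>
    (rlb_col_supp b n k).subset (Function.support_const_smul_subset _ _)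
  have hZ1 : ∀ (b : ℕ → ℕ → ℝ) n ω, nn (matVecSeq b n (fun i => X (i + 1) ω)) ≤
      ∑ k ∈ Finset.Icc 1 n, nn (colSeq b n k) * X k ω := by
    intro b n ω
    rw [rlb_matVec_eq]
    refine (rlb_nn_sum nn hnn_tri hnn_smul _ _ fun k => hsm b n k _).trans (le_of_eq ?_)
    refine Finset.sum_congr rfl fun k hk => ?_
    have : k - 1 + 1 = k := Nat.sub_add_cancel (Finset.mem_Icc.1 hk).1
    rw [hnn_smul _ _ (rlb_col_supp b n k), this, abs_of_nonneg (hXnonneg _ _), mul_comm]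
  have hZ2 : ∀ (b : ℕ → ℕ → ℝ) n ω, ∀ i ∈ Finset.Icc 1 n, nn (colSeq b n i) * X i ω -
      ∑ k ∈ (Finset.Icc 1 n).erase i, nn (colSeq b n k) * X k ω ≤
        nn (matVecSeq b n (fun i => X (i + 1) ω)) := by
    intro b n ω i hi
    have hterm : ∀ k ∈ Finset.Icc 1 n, nn (X (k - 1 + 1) ω • colSeq b n k) =
        nn (colSeq b n k) * X k ω := by
      intro k hk
      have : k - 1 + 1 = k := Nat.sub_add_cancel (Finset.mem_Icc.1 hk).1
      rw [hnn_smul _ _ (rlb_col_supp b n k), this, abs_of_nonneg (hXnonneg _ _), mul_comm]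
    have hr := rlb_nn_sum nn hnn_tri hnn_smul ((Finset.Icc 1 n).erase i)
      (fun k => X (k - 1 + 1) ω • colSeq b n k) fun k => hsm b n k _
    rw [Finset.sum_congr rfl fun k hk => hterm k (Finset.mem_of_mem_erase hk)] at hr
    set R := ∑ k ∈ (Finset.Icc 1 n).erase i, X (k - 1 + 1) ω • colSeq b n k with hR
    have hRs : (Function.support R).Finite := rlb_sum_supp _ _ fun k => hsm b n k _
    have hM : matVecSeq b n (fun i => X (i + 1) ω) = X (i - 1 + 1) ω • colSeq b n i + R := by
      rw [rlb_matVec_eq, hR,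
        Finset.add_sum_erase (Finset.Icc 1 n) (fun k => X (k - 1 + 1) ω • colSeq b n k) hi]
    have hneg : nn ((-1 : ℝ) • R) = nn R := by rw [hnn_smul _ _ hRs]; simp
    have hRs' : (Function.support ((-1 : ℝ) • R)).Finite :=
      hRs.subset (Function.support_const_smul_subset _ _)
    have h3 := hnn_tri (matVecSeq b n (fun i => X (i + 1) ω)) ((-1 : ℝ) • R)
      (rlb_supp _ n (rlb_matVec_supp _ _ _)) hRs'
    have h4 : matVecSeq b n (fun i => X (i + 1) ω) + (-1 : ℝ) • R =
        X (i - 1 + 1) ω • colSeq b n i := by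
      rw [hM]; simp
    rw [h4, hneg, hterm i hi] at h3
    linarith
  -- measurability
  have hcolm : ∀ n k, Measurable fun y : ℕ × ℕ → ℝ => nn (colSeq (fun i j => y (i, j)) n k) := by
    intro n k
    refine rlb_nn_meas nn hnn_tri hnn_upper n _ (fun i => ?_) (fun y i hi => by simp [colSeq, hi])
    simp only [colSeq]
    split_ifs
    · fun_prop
    · fun_prop
  set Y : Ω → (ℕ × ℕ → ℝ) × ℕ := fun ω => (fun q => a q.1 q.2 ω, N ω) with hYdef
  have hA : Measurable fun ω => fun q : ℕ × ℕ => a q.1 q.2 ω :=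
    measurable_pi_lambda _ fun q => hameas q.1 q.2
  have hY : Measurable Y := hA.prodMk hNmeas
  have hXs : Measurable fun ω => fun i : ℕ => X i ω := measurable_pi_lambda _ hXmeas
  have hW : Measurable fun q : ((ℕ × ℕ → ℝ) × ℕ) × (ℕ → ℝ) =>
      nn (matVecSeq (fun i j => q.1.1 (i, j)) q.1.2 (fun i => q.2 (i + 1))) := by
    have h1 : Measurable fun q : ((ℕ × ℕ → ℝ) × (ℕ → ℝ)) × ℕ =>
        nn (matVecSeq (fun i j => q.1.1 (i, j)) q.2 (fun i => q.1.2 (i + 1))) := by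
      refine measurable_from_prod_countable_left fun n => ?_
      refine rlb_nn_meas nn hnn_tri hnn_upper n _ (fun i => ?_)
        (fun y i hi => rlb_matVec_supp _ _ _ i hi)
      simp only [matVecSeq]
      split_ifs
      · fun_prop
      · fun_prop
    have h2 : Measurable fun q : ((ℕ × ℕ → ℝ) × ℕ) × (ℕ → ℝ) => ((q.1.1, q.2), q.1.2) := by
      fun_prop
    exact h1.comp h2
  have hind := rlb_indep P _ _ N hA hXs hNmeas haX_indep hN_indep
  have hfub := fun x : ℝ => rlb_fubini P Y _ hY hXs hind
    {q | x < nn (matVecSeq (fun i j => q.1.1 (i, j)) q.1.2 (fun i => q.2 (i + 1)))}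
    (measurableSet_lt measurable_const hW)
  simp only [Set.mem_ofPred_eq, hYdef] at hfub
  set G : ℝ → Ω → ℝ := fun x ω => P.real {ω' | x < nn (matVecSeq (fun i j => a i j ω) (N ω)
    (fun i => X (i + 1) ω'))} with hG
  set S : Ω → ℝ := fun ω => ∑ k ∈ Finset.Icc 1 (N ω),
    K * (1 + (nn (colSeq (fun i j => a i j ω) (N ω) k) * N ω) ^ (α + ε)) with hS
  have hSm : Measurable S := by
    have : Measurable fun q : (ℕ × ℕ → ℝ) × ℕ => ∑ k ∈ Finset.Icc 1 q.2,
        K * (1 + (nn (colSeq (fun i j => q.1 (i, j)) q.2 k) * q.2) ^ (α + ε)) := by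
      refine measurable_from_prod_countable_left fun n => ?_
      have hterm : ∀ k ∈ Finset.Icc 1 n, Measurable fun y : ℕ × ℕ → ℝ =>
          K * (1 + (nn (colSeq (fun i j => y (i, j)) n k) * (n : ℝ)) ^ (α + ε)) := by
        intro k _
        exact ((((hcolm n k).mul_const _).pow_const _).const_add _).const_mul _
      exact Finset.measurable_fun_sum _ hterm
    have h2 := this.comp hY
    simp only [Function.comp_def, hYdef] at h2
    exact h2
  have hS0 : ∀ ω, 0 ≤ S ω := by
    intro ω
    refine Finset.sum_nonneg fun k _ => ?_
    have : 0 ≤ (nn (colSeq (fun i j => a i j ω) (N ω) k) * N ω) ^ (α + ε) :=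
      Real.rpow_nonneg (mul_nonneg (hc0 _ _ _) (by positivity)) _
    positivity
  have hSle : ∀ ω, S ω ≤ K * ((N ω : ℝ) ^ ((2:ℝ) + α + ε') +
      seqOpNorm nn (fun i j => a i j ω) (N ω) ^ (α + ε) * (N ω : ℝ) ^ ((1 : ℝ) + α + ε)) := by
    intro ω
    have hN1 : (1:ℝ) ≤ N ω := by exact_mod_cast hNpos ω
    set M := seqOpNorm nn (fun i j => a i j ω) (N ω) with hM
    have hcM : ∀ k ∈ Finset.Icc 1 (N ω), nn (colSeq (fun i j => a i j ω) (N ω) k) ≤ M :=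
      fun k hk => rlb_col_le nn hnn_lower hnn_upper _ _ k hk
    have hM0 : 0 ≤ M := (hc0 _ _ _).trans (hcM 1 (Finset.mem_Icc.2 ⟨le_rfl, hNpos ω⟩))
    have h1 : S ω ≤ (N ω : ℝ) * (K * (1 + (M * N ω) ^ (α + ε))) := by
      have := Finset.sum_le_card_nsmul (Finset.Icc 1 (N ω))
        (fun k => K * (1 + (nn (colSeq (fun i j => a i j ω) (N ω) k) * N ω) ^ (α + ε)))
        (K * (1 + (M * N ω) ^ (α + ε))) (fun k hk => by
          refine mul_le_mul_of_nonneg_left (add_le_add_right ?_ _) hK.le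
          refine Real.rpow_le_rpow (mul_nonneg (hc0 _ _ _) (by positivity)) ?_ (by linarith)
          exact mul_le_mul_of_nonneg_right (hcM k hk) (by positivity))
      rwa [nsmul_eq_mul, Nat.card_Icc, Nat.add_sub_cancel] at this
    refine h1.trans ?_
    have h2 : (N ω : ℝ) ≤ (N ω : ℝ) ^ ((2:ℝ) + α + ε') := by
      conv_lhs => rw [← Real.rpow_one (N ω : ℝ)]
      exact Real.rpow_le_rpow_of_exponent_le hN1 (by linarith)
    have h3 : (N ω : ℝ) ^ ((1 : ℝ) + α + ε) = N ω * (N ω : ℝ) ^ (α + ε) := by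
      rw [add_assoc, Real.rpow_add (by linarith), Real.rpow_one]
    rw [h3, Real.mul_rpow hM0 (by linarith)]
    have := mul_le_mul_of_nonneg_left h2 hK.le
    nlinarith
  have hSint : Integrable S P := by
    refine ⟨hSm.aestronglyMeasurable, ?_⟩
    rw [hasFiniteIntegral_iff_ofReal (ae_of_all _ hS0)]
    have hNm : Measurable fun ω => ENNReal.ofReal ((N ω : ℝ) ^ ((2 : ℝ) + α + ε')) := by
      fun_prop
    calc ∫⁻ ω, ENNReal.ofReal (S ω) ∂P ≤ ∫⁻ ω, ENNReal.ofReal K *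
          (ENNReal.ofReal ((N ω : ℝ) ^ ((2 : ℝ) + α + ε')) +
          ENNReal.ofReal (seqOpNorm nn (fun i j => a i j ω) (N ω) ^ (α + ε)
            * (N ω : ℝ) ^ ((1 : ℝ) + α + ε))) ∂P := by
          refine lintegral_mono fun ω => ?_
          refine (ENNReal.ofReal_le_ofReal (hSle ω)).trans ?_
          rw [ENNReal.ofReal_mul hK.le]
          gcongr
          exact ENNReal.ofReal_add_le
      _ = ENNReal.ofReal K * (∫⁻ ω, ENNReal.ofReal ((N ω : ℝ) ^ ((2 : ℝ) + α + ε')) ∂P +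
          ∫⁻ ω, ENNReal.ofReal (seqOpNorm nn (fun i j => a i j ω) (N ω) ^ (α + ε)
            * (N ω : ℝ) ^ ((1 : ℝ) + α + ε)) ∂P) := by
          rw [lintegral_const_mul' _ _ ENNReal.ofReal_ne_top, lintegral_add_left hNm]
      _ < ⊤ := ENNReal.mul_lt_top ENNReal.ofReal_lt_top (ENNReal.add_lt_top.2 ⟨hNint, hAint⟩)
  have hmain : Tendsto (fun x => ∫ ω, G x ω / P.real {ω | x < X 1 ω} ∂P) atTop
      (nhds (∫ ω, ∑ k ∈ Finset.Icc 1 (N ω),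
        nn (colSeq (fun i j => a i j ω) (N ω) k) ^ α ∂P)) := by
    refine tendsto_integral_filter_of_dominated_convergence S ?_ ?_ hSint ?_
    · exact Eventually.of_forall fun x => ((hfub x).2.div_const _).aestronglyMeasurable
    · filter_upwards [eventually_ge_atTop x0] with x hx
      refine ae_of_all _ fun ω => ?_
      rw [Real.norm_of_nonneg (div_nonneg measureReal_nonneg measureReal_nonneg),
        div_le_iff₀ (hF0 x)]
      exact rlb_dom P X hXid K (α + ε) x0 hK hx0 hpot (N ω) (hNpos ω)
        (fun k => nn (colSeq (fun i j => a i j ω) (N ω) k)) (fun k => hc0 _ _ _)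
        (fun ω' => nn (matVecSeq (fun i j => a i j ω) (N ω) (fun i => X (i + 1) ω')))
        (fun ω' => hZ1 _ _ ω') x hx
    · refine ae_of_all _ fun ω => ?_
      exact rlb_pointwise P X hXmeas hXnonneg hXid α hα hF0 hRV hUAI (N ω) (hNpos ω)
        (fun k => nn (colSeq (fun i j => a i j ω) (N ω) k)) (fun k => hc0 _ _ _)
        (fun ω' => nn (matVecSeq (fun i j => a i j ω) (N ω) (fun i => X (i + 1) ω')))
        (fun ω' => hZ1 _ _ ω') (fun ω' => hZ2 _ _ ω')
  refine hmain.congr fun x => ?_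
  rw [integral_div, ← (hfub x).1]
  rfl
end

section
/- Let (X_i)_{i≥1} be identically distributed nonnegative random variables such that X₁ is regularly varying with index α > 0 and the family is uniformly asymptotically independent. Let (a_{i,j})_{i,j≥1} be a doubly indexed family of nonnegative random variables independent of (X_i), and let N be a positive integer-valued random variable, independent of (X_i) and of (a_{i,j}), with E[N^{2+α+ε}] < ∞ for some ε > 0. Let ‖·‖ be a norm on the space of finitely supported real sequences satisfying sup_i |u_i| ≤ ‖u‖ ≤ ∑_i |u_i|; write A(N) = (a_{i,j})_{1≤i,j≤N}, assume E[‖A(N)‖^{α+ε} N^{1+α+ε}] < ∞ for some ε > 0 (‖A(N)‖ the induced operator norm), and assume E[∑_{k=1}^N ‖A_k(N)‖^α] > 0 where A_k(N) is the k-th column of A(N) viewed as a finitely supported sequence. Define C(N) by C_i = ∑_{j=1}^N a_{i,j} X_j for i ≤ N and C_i = 0 for i > N. Then for every bounded continuous function f on the normed space of finitely supported sequences, lim_{x→∞} E[ f(C(N)/‖C(N)‖) · 1_{‖C(N)‖>x} ] / P(‖C(N)‖ > x) = E[ ∑_{k=1}^N ‖A_k(N)‖^α f(A_k(N)/‖A_k(N)‖)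 ] / E[ ∑_{k=1}^N ‖A_k(N)‖^α ], where summands with A_k(N) = 0 are interpreted as 0. -/
open MeasureTheory ProbabilityTheory Filter

structure IsSN (nn : (ℕ → ℝ) → ℝ) : Prop where
  tri : ∀ u v : ℕ → ℝ, (Function.support u).Finite → (Function.support v).Finite →
      nn (u + v) ≤ nn u + nn v
  smul : ∀ (c : ℝ) (u : ℕ → ℝ), (Function.support u).Finite → nn (c • u) = |c| * nn u
  lower : ∀ u : ℕ → ℝ, (Function.support u).Finite → ∀ i, |u i| ≤ nn u
  upper : ∀ u : ℕ → ℝ, (Function.support u).Finite → nn u ≤ ∑' i, |u i|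

def SuppIn (n : ℕ) (u : ℕ → ℝ) : Prop := ∀ i, n ≤ i → u i = 0

lemma SuppIn.fin {n : ℕ} {u : ℕ → ℝ} (h : SuppIn n u) : (Function.support u).Finite := by
  refine (Set.finite_lt_nat n).subset fun i hi => ?_
  by_contra hc
  exact hi (h i (not_lt.mp hc))

lemma SuppIn.add {n : ℕ} {u v : ℕ → ℝ} (h : SuppIn n u) (h' : SuppIn n v) : SuppIn n (u + v) :=
  fun i hi => by simp [h i hi, h' i hi]

lemma SuppIn.sub {n : ℕ} {u v : ℕ → ℝ} (h : SuppIn n u) (h' : SuppIn n v) : SuppIn n (u - v) :=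
  fun i hi => by simp [h i hi, h' i hi]

lemma SuppIn.smul {n : ℕ} {u : ℕ → ℝ} (h : SuppIn n u) (c : ℝ) : SuppIn n (c • u) :=
  fun i hi => by simp [h i hi]

lemma SuppIn.sum {n : ℕ} {ι : Type*} {s : Finset ι} {u : ι → ℕ → ℝ}
    (h : ∀ k ∈ s, SuppIn n (u k)) : SuppIn n (∑ k ∈ s, u k) :=
  fun i hi => by
    rw [Finset.sum_apply]
    exact Finset.sum_eq_zero fun k hk => h k hk i hi

lemma IsSN.nonneg {nn : (ℕ → ℝ) → ℝ} (H : IsSN nn) {n : ℕ} {u : ℕ → ℝ} (h : SuppIn n u) :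
    0 ≤ nn u := (abs_nonneg _).trans (H.lower u h.fin 0)

lemma IsSN.zero {nn : (ℕ → ℝ) → ℝ} (H : IsSN nn) : nn 0 = 0 := by
  have := H.smul 0 0 (by simp)
  simpa using this

lemma IsSN.sum_le {nn : (ℕ → ℝ) → ℝ} (H : IsSN nn) {n : ℕ} {ι : Type*} (s : Finset ι)
    {u : ι → ℕ → ℝ} (h : ∀ k ∈ s, SuppIn n (u k)) : nn (∑ k ∈ s, u k) ≤ ∑ k ∈ s, nn (u k) := by
  classical
  induction s using Finset.induction_on with
  | empty => simp [H.zero]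
  | insert a s ha ih =>
    rw [Finset.sum_insert ha, Finset.sum_insert ha]
    have h1 : ∀ k ∈ s, SuppIn n (u k) := fun k hk => h k (Finset.mem_insert_of_mem hk)
    exact (H.tri _ _ (h a (Finset.mem_insert_self _ _)).fin (SuppIn.sum h1).fin).trans
      (by linarith [ih h1])

lemma IsSN.sub_comm {nn : (ℕ → ℝ) → ℝ} (H : IsSN nn) {n : ℕ} {u v : ℕ → ℝ}
    (hu : SuppIn n u) (hv : SuppIn n v) : nn (u - v) = nn (v - u) := by
  have := H.smul (-1) (v - u) (hv.sub hu).fin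
  simpa using this

lemma IsSN.abs_sub_le {nn : (ℕ → ℝ) → ℝ} (H : IsSN nn) {n : ℕ} {u v : ℕ → ℝ}
    (hu : SuppIn n u) (hv : SuppIn n v) : |nn u - nn v| ≤ nn (u - v) := by
  have h1 := H.tri (u - v) v (hu.sub hv).fin hv.fin
  have h2 := H.tri (v - u) u (hv.sub hu).fin hu.fin
  rw [sub_add_cancel] at h1 h2
  rw [H.sub_comm hv hu] at h2
  rw [abs_le]; constructor <;> linarith

lemma IsSN.le_sum {nn : (ℕ → ℝ) → ℝ} (H : IsSN nn) {n : ℕ} {u : ℕ → ℝ}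
    (hu : SuppIn n u) : nn u ≤ ∑ i ∈ Finset.range n, |u i| := by
  refine (H.upper u hu.fin).trans (le_of_eq ?_)
  refine tsum_eq_sum fun i hi => ?_
  rw [hu i (by simpa using hi), abs_zero]

/-- normalized direction estimate -/
lemma IsSN.dir {nn : (ℕ → ℝ) → ℝ} (H : IsSN nn) {n : ℕ} {u v : ℕ → ℝ}
    (hu : SuppIn n u) (hv : SuppIn n v) {t : ℝ} (ht : 0 < t) (hu0 : 0 < nn u) (hv0 : 0 < nn v) :
    nn (fun i => u i / nn u - v i / nn v) ≤ 2 * nn (u - t • v) / nn u := by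
  have e : (fun i => u i / nn u - v i / nn v) =
      (nn u)⁻¹ • (u - t • v) + ((t * nn v - nn u) / (nn u * nn v)) • v := by
    funext i
    simp only [Pi.add_apply, Pi.smul_apply, Pi.sub_apply, smul_eq_mul]
    field_simp
    ring
  rw [e]
  have s1 := hu.sub (hv.smul t)
  refine (H.tri _ _ (s1.smul _).fin (hv.smul _).fin).trans ?_
  rw [H.smul _ _ s1.fin, H.smul _ _ hv.fin]
  have h1 := H.abs_sub_le hu (hv.smul t)
  rw [H.smul _ _ hv.fin, abs_of_pos ht] at h1
  rw [abs_div, abs_of_pos (inv_pos.mpr hu0), abs_of_pos (mul_pos hu0 hv0), abs_sub_comm]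
  have : |nn u - t * nn v| / (nn u * nn v) * nn v = |nn u - t * nn v| / nn u := by
    field_simp
  rw [this, ← sub_nonneg]
  have e2 : 2 * nn (u - t • v) / nn u - ((nn u)⁻¹ * nn (u - t • v) + |nn u - t * nn v| / nn u)
    = (nn (u - t • v) - |nn u - t * nn v|) / nn u := by field_simp; ring
  rw [e2]
  exact div_nonneg (by linarith) hu0.le

def extSeq (n : ℕ) (u : Fin n → ℝ) : ℕ → ℝ := fun i => if h : i < n then u ⟨i, h⟩ else 0

lemma extSeq_supp (n : ℕ) (u : Fin n → ℝ) : SuppIn n (extSeq n u) := fun i hi => by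
  simp [extSeq, not_lt.mpr hi]

lemma extSeq_dist {nn : (ℕ → ℝ) → ℝ} (H : IsSN nn) (n : ℕ) (u : Fin n → ℝ) :
    Tendsto (fun v => nn (extSeq n v - extSeq n u)) (nhds u) (nhds 0) := by
  have hle : ∀ v, nn (extSeq n v - extSeq n u) ≤
      ∑ i ∈ Finset.range n, |extSeq n v i - extSeq n u i| := fun v => by
    simpa using H.le_sum ((extSeq_supp n v).sub (extSeq_supp n u))
  refine tendsto_of_tendsto_of_tendsto_of_le_of_le tendsto_const_nhds ?_
    (fun v => H.nonneg ((extSeq_supp n v).sub (extSeq_supp n u))) hle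
  have hc : Continuous fun v : Fin n → ℝ =>
      ∑ i ∈ Finset.range n, |extSeq n v i - extSeq n u i| := by
    refine continuous_finsetSum _ fun i _ => ?_
    have : Continuous fun v : Fin n → ℝ => extSeq n v i := by
      unfold extSeq
      by_cases h : i < n
      · simp only [h, dite_true]; exact continuous_apply _
      · simp only [h, dite_false]; exact continuous_const
    exact (this.sub continuous_const).abs
  simpa using hc.tendsto u

def NCont (nn : (ℕ → ℝ) → ℝ) (f : (ℕ → ℝ) → ℝ) : Prop :=
  ∀ u : ℕ → ℝ, ∀ ε : ℝ, 0 < ε → ∃ δ : ℝ, 0 < δ ∧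
      ∀ v : ℕ → ℝ, nn (fun i => v i - u i) < δ → |f v - f u| < ε

lemma ext_f_cont {nn : (ℕ → ℝ) → ℝ} (H : IsSN nn) {f : (ℕ → ℝ) → ℝ} (hf : NCont nn f) (n : ℕ) :
    Continuous fun u : Fin n → ℝ => f (extSeq n u) := by
  rw [continuous_iff_continuousAt]
  intro u
  rw [ContinuousAt, Metric.tendsto_nhds]
  intro ε hε
  obtain ⟨δ, hδ, h⟩ := hf (extSeq n u) ε hε
  filter_upwards [(extSeq_dist H n u).eventually (gt_mem_nhds hδ)] with v hv
  exact h _ hv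

lemma ext_nn_cont {nn : (ℕ → ℝ) → ℝ} (H : IsSN nn) (n : ℕ) :
    Continuous fun u : Fin n → ℝ => nn (extSeq n u) := by
  rw [continuous_iff_continuousAt]
  intro u
  rw [ContinuousAt, Metric.tendsto_nhds]
  intro ε hε
  filter_upwards [(extSeq_dist H n u).eventually (gt_mem_nhds hε)] with v hv
  exact (H.abs_sub_le (extSeq_supp n v) (extSeq_supp n u)).trans_lt hv

lemma meas_of_ext {β : Type*} [MeasurableSpace β] {g : (ℕ → ℝ) → ℝ} {n : ℕ}
    (hg : Continuous fun u : Fin n → ℝ => g (extSeq n u)) {v : β → ℕ → ℝ}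
    (hv : ∀ b, SuppIn n (v b)) (hm : ∀ i, Measurable fun b => v b i) :
    Measurable fun b => g (v b) := by
  have e : (fun b => g (v b)) = (fun u : Fin n → ℝ => g (extSeq n u)) ∘
      (fun b => fun i : Fin n => v b i) := by
    funext b
    simp only [Function.comp]
    congr 1
    funext i
    unfold extSeq
    split_ifs with h
    · rfl
    · exact hv b i (not_lt.mp h)
  rw [e]
  exact hg.measurable.comp (measurable_pi_lambda _ fun i => hm i)

lemma colSeq_supp (a : ℕ → ℕ → ℝ) (n k : ℕ) : SuppIn n (colSeq a n k) := fun i hi => by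
  simp [colSeq]; omega

lemma matVec_supp (a : ℕ → ℕ → ℝ) (n : ℕ) (u : ℕ → ℝ) : SuppIn n (matVecSeq a n u) :=
  fun i hi => by
  simp [matVecSeq]; omega

lemma matVec_eq (a : ℕ → ℕ → ℝ) (n : ℕ) (x : ℕ → ℝ) :
    matVecSeq a n (fun i => x (i + 1)) = ∑ j ∈ Finset.Icc 1 n, x j • colSeq a n j := by
  funext i
  rw [Finset.sum_apply]
  simp only [matVecSeq, colSeq, Pi.smul_apply, smul_eq_mul]
  split_ifs with h
  · refine Finset.sum_congr rfl fun j hj => ?_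
    rw [Nat.sub_add_cancel (Finset.mem_Icc.mp hj).1, mul_comm]
  · simp

lemma col_le_op {nn : (ℕ → ℝ) → ℝ} (H : IsSN nn) (a : ℕ → ℕ → ℝ) (n k : ℕ)
    (hk : k ∈ Finset.Icc 1 n) : nn (colSeq a n k) ≤ seqOpNorm nn a n := by
  obtain ⟨hk1, hk2⟩ := Finset.mem_Icc.mp hk
  have hs : SuppIn n (Pi.single (k - 1) (1 : ℝ) : ℕ → ℝ) := fun i hi => by
    rw [Pi.single_apply, if_neg (by omega)]
  have h1 : nn (Pi.single (k - 1) (1 : ℝ)) ≤ 1 := by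
    refine (H.upper _ hs.fin).trans (le_of_eq ?_)
    rw [tsum_eq_single (k - 1)]
    · simp
    · intro b hb; simp [hb]
  have e : matVecSeq a n (Pi.single (k - 1) (1 : ℝ)) = colSeq a n k := by
    funext i
    simp only [matVecSeq, colSeq]
    split_ifs with h
    · rw [Finset.sum_eq_single k]
      · simp
      · intro b hb hbk
        have := (Finset.mem_Icc.mp hb).1
        rw [Pi.single_apply, if_neg (by omega), mul_zero]
      · intro h; exact absurd hk h
    · rfl
  have hb : BddAbove (Set.range fun u : {u : ℕ → ℝ // nn u ≤ 1 ∧ ∀ i, n ≤ i → u i = 0} =>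
      nn (matVecSeq a n (u : ℕ → ℝ))) := by
    refine ⟨∑ i ∈ Finset.range n, ∑ j ∈ Finset.Icc 1 n, |a (i + 1) j|, ?_⟩
    rintro _ ⟨⟨u, hu1, hu2⟩, rfl⟩
    refine (H.le_sum (matVec_supp a n u)).trans ?_
    refine Finset.sum_le_sum fun i hi => ?_
    have hi' : i + 1 ≤ n := by simpa using hi
    simp only [matVecSeq, hi', if_true]
    refine (Finset.abs_sum_le_sum_abs _ _).trans (Finset.sum_le_sum fun j _ => ?_)
    rw [abs_mul]
    have : |u (j - 1)| ≤ 1 := (H.lower u (SuppIn.fin hu2) _).trans hu1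
    nlinarith [abs_nonneg (a (i + 1) j)]
  have := le_ciSup hb ⟨Pi.single (k - 1) (1 : ℝ), h1, hs⟩
  rw [seqOpNorm]
  simpa only [e] using this

lemma potter_real (p : ℝ → ℝ) (hanti : Antitone p) (hpos : ∀ x, 0 < x → 0 < p x)
    (hle : ∀ x, p x ≤ 1) (α β : ℝ) (hα : 0 < α) (hβ : α < β)
    (hRV : Tendsto (fun x => p ((1 / 2) * x) / p x) atTop (nhds ((1 / 2 : ℝ) ^ (-α)))) :
    ∃ x₀ K : ℝ, 0 < x₀ ∧ 0 ≤ K ∧ ∀ x ≥ x₀, ∀ c : ℝ, 0 < c → p (x / c) ≤ K * (1 + c ^ β) * p x := by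
  have hlt : (1 / 2 : ℝ) ^ (-α) < 2 ^ β := by
    rw [one_div, Real.inv_rpow (by norm_num), ← Real.rpow_neg (by norm_num), neg_neg]
    exact Real.rpow_lt_rpow_of_exponent_lt (by norm_num) hβ
  obtain ⟨x₁, hx₁⟩ := eventually_atTop.mp (hRV.eventually (gt_mem_nhds hlt))
  set x₀ := max x₁ 1 with hx₀
  have h0 : 0 < x₀ := lt_of_lt_of_le one_pos (le_max_right _ _)
  have hstep : ∀ x ≥ x₀, p (x / 2) ≤ 2 ^ β * p x := fun x hx => by
    have h1 := hx₁ x ((le_max_left _ _).trans hx)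
    have hp := hpos x (h0.trans_le hx)
    rw [div_lt_iff₀ hp] at h1
    rw [show x / 2 = 1 / 2 * x by ring]
    exact h1.le
  set L := 1 / p (2 * x₀) with hL
  have hp2 : 0 < p (2 * x₀) := hpos _ (by linarith)
  have hL1 : 1 ≤ L := by
    rw [hL, le_div_iff₀ hp2]; linarith [hle (2 * x₀)]
  have h2β : (1 : ℝ) ≤ 2 ^ β := Real.one_le_rpow (by norm_num) (by linarith)
  have hind : ∀ m : ℕ, ∀ x ≥ x₀, p (x / 2 ^ m) ≤ L * (2 ^ β) ^ m * p x := by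
    intro m
    induction m with
    | zero => intro x hx; have := hpos x (h0.trans_le hx); simp; nlinarith
    | succ m ih =>
      intro x hx
      have hp := hpos x (h0.trans_le hx)
      by_cases hc : x₀ ≤ x / 2
      · have h1 := ih _ hc
        have e : x / 2 ^ (m + 1) = x / 2 / 2 ^ m := by rw [pow_succ]; field_simp
        rw [e]
        refine h1.trans ?_
        have := hstep x hx
        calc L * (2 ^ β) ^ m * p (x / 2) ≤ L * (2 ^ β) ^ m * (2 ^ β * p x) := by gcongr
          _ = _ := by rw [pow_succ]; ring
      · have h1 : p (2 * x₀) ≤ p x := hanti (by linarith)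
        have h2 : 1 ≤ L * p x := by
          rw [hL, div_mul_eq_mul_div, one_mul, le_div_iff₀ hp2]; linarith
        have h3 : (1 : ℝ) ≤ (2 ^ β) ^ (m + 1) := one_le_pow₀ h2β
        calc p (x / 2 ^ (m + 1)) ≤ 1 := hle _
          _ ≤ L * p x * (2 ^ β) ^ (m + 1) := by nlinarith
          _ = _ := by ring
  refine ⟨x₀, L * 2 ^ β, h0, by positivity, fun x hx c hc => ?_⟩
  have hp := hpos x (h0.trans_le hx)
  have hcβ : 0 < c ^ β := Real.rpow_pos_of_pos hc _
  by_cases h1 : c ≤ 1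
  · have : p (x / c) ≤ p x := hanti (by
      rw [le_div_iff₀ hc]; nlinarith [h0.trans_le hx])
    have h5 : 1 ≤ L * 2 ^ β := by nlinarith
    have h6 : 1 ≤ L * 2 ^ β * (1 + c ^ β) := by nlinarith
    nlinarith
  · obtain ⟨m, hm1, hm2⟩ := exists_nat_pow_near (not_le.mp h1).le (one_lt_two : (1 : ℝ) < 2)
    have hx0 := h0.trans_le hx
    have : p (x / c) ≤ p (x / 2 ^ (m + 1)) := hanti (by gcongr)
    refine this.trans ((hind _ x hx).trans ?_)
    have h7 : ((2 : ℝ) ^ β) ^ m ≤ c ^ β := by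
      rw [← Real.rpow_natCast, ← Real.rpow_mul (by norm_num), mul_comm, Real.rpow_mul (by norm_num),
        Real.rpow_natCast]
      exact Real.rpow_le_rpow (by positivity) hm1 (by linarith)
    rw [pow_succ]
    have h8 : ((2 : ℝ) ^ β) ^ m ≤ 1 + c ^ β := by linarith
    calc L * ((2 ^ β) ^ m * 2 ^ β) * p x = L * 2 ^ β * (2 ^ β) ^ m * p x := by ring
      _ ≤ _ := by gcongr

lemma indep_assoc {Ω A B C : Type*} [MeasurableSpace Ω] [MeasurableSpace A] [MeasurableSpace B]
    [MeasurableSpace C] (P : Measure Ω) [IsProbabilityMeasure P] {a : Ω → A} {b : Ω → B}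
    {c : Ω → C} (ha : Measurable a) (hb : Measurable b) (hc : Measurable c)
    (h1 : IndepFun b c P) (h2 : IndepFun a (fun ω => (c ω, b ω)) P) :
    IndepFun (fun ω => (a ω, b ω)) c P := by
  have h3 : IndepFun a (fun ω => (b ω, c ω)) P :=
    h2.comp measurable_id measurable_swap
  have h4 : IndepFun a b P := h2.comp measurable_id measurable_snd
  have ma := Measure.isProbabilityMeasure_map (μ := P) ha.aemeasurable
  have mb := Measure.isProbabilityMeasure_map (μ := P) hb.aemeasurable
  have mc := Measure.isProbabilityMeasure_map (μ := P) hc.aemeasurable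
  rw [indepFun_iff_map_prod_eq_prod_map_map ha.aemeasurable (hb.prodMk hc).aemeasurable] at h3
  rw [indepFun_iff_map_prod_eq_prod_map_map hb.aemeasurable hc.aemeasurable] at h1
  rw [indepFun_iff_map_prod_eq_prod_map_map ha.aemeasurable hb.aemeasurable] at h4
  rw [indepFun_iff_map_prod_eq_prod_map_map (ha.prodMk hb).aemeasurable hc.aemeasurable, h4]
  rw [h1] at h3
  have e : (fun ω => ((a ω, b ω), c ω)) =
      (MeasurableEquiv.prodAssoc.symm : A × B × C → (A × B) × C) ∘ (fun ω => (a ω, (b ω, c ω))) := by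
    rfl
  rw [e, ← Measure.map_map (MeasurableEquiv.measurable _) (by fun_prop), h3]
  rw [← Measure.prodAssoc_prod, Measure.map_map (MeasurableEquiv.measurable _) (MeasurableEquiv.measurable _)]
  simp

lemma integral_indep {Ω A B : Type*} [MeasurableSpace Ω] [MeasurableSpace A] [MeasurableSpace B]
    (P : Measure Ω) [IsProbabilityMeasure P] {a : Ω → A} {b : Ω → B}
    (ha : Measurable a) (hb : Measurable b) (h : IndepFun a b P) (g : A × B → ℝ)
    (hg : Measurable g) (M : ℝ) (hM : ∀ x, |g x| ≤ M) :
    (∫ ω, g (a ω, b ω) ∂P) = ∫ ω, ∫ ω', g (a ω, b ω') ∂P ∂P ∧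
    Measurable fun ω => ∫ ω', g (a ω, b ω') ∂P := by
  have ma := Measure.isProbabilityMeasure_map (μ := P) ha.aemeasurable
  have mb := Measure.isProbabilityMeasure_map (μ := P) hb.aemeasurable
  rw [indepFun_iff_map_prod_eq_prod_map_map ha.aemeasurable hb.aemeasurable] at h
  have hm : Measurable fun x : A => ∫ y, g (x, y) ∂(P.map b) :=
    (hg.stronglyMeasurable.integral_prod_right').measurable
  have e : ∀ x, ∫ y, g (x, y) ∂(P.map b) = ∫ ω', g (x, b ω') ∂P := fun x =>
    integral_map hb.aemeasurable (hg.comp measurable_prodMk_left).aestronglyMeasurable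
  constructor
  · rw [← integral_map (ha.prodMk hb).aemeasurable (φ := fun ω => (a ω, b ω)) (f := g)
      hg.aestronglyMeasurable, h, integral_prod]
    · rw [integral_map ha.aemeasurable hm.aestronglyMeasurable]
      simp_rw [e]
    · exact Integrable.of_bound hg.aestronglyMeasurable M (ae_of_all _ hM)
  · simp_rw [e] at hm
    exact hm.comp ha

lemma pointwise_bound {nn : (ℕ → ℝ) → ℝ} (H : IsSN nn) (f : (ℕ → ℝ) → ℝ) (M : ℝ)
    (hM : ∀ u, |f u| ≤ M) (n : ℕ) (s : Finset ℕ) (v : ℕ → ℕ → ℝ) (hv : ∀ k, SuppIn n (v k))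
    (x : ℕ → ℝ) (hx : ∀ k, 0 ≤ x k) (δ η ε ρ t : ℝ) (ht : 0 < t) (hδ : 0 < δ) (hη1 : η < 1)
    (hε : 0 ≤ ε) (hδη : δ * ∑ k ∈ s, nn (v k) ≤ η) (hη0 : 0 < η) (hρ : 2 * η < ρ)
    (hf : ∀ k ∈ s, ∀ w : ℕ → ℝ, nn (fun i => w i - v k i / nn (v k)) < ρ →
      |f w - f (fun i => v k i / nn (v k))| ≤ ε) (C : ℕ → ℝ) (hC : C = ∑ k ∈ s, x k • v k) :
    |(if t < nn C then f (fun i => C i / nn C) else 0)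
      - ∑ k ∈ s, (if t < nn (v k) * x k then f (fun i => v k i / nn (v k)) else 0)| ≤
    ∑ k ∈ s, ((ε + M) * (if (1 - η) * t < nn (v k) * x k then 1 else 0)
        - M * (if (1 + η) * t < nn (v k) * x k then 1 else 0))
    + ∑ k ∈ s, ∑ j ∈ s, (if k ≠ j ∧ δ * t < x k ∧ δ * t < x j then ((s.card : ℝ) + 1) * M else 0) := by
  have hM0 : 0 ≤ M := (abs_nonneg _).trans (hM 0)
  have hb : ∀ k, 0 ≤ nn (v k) := fun k => H.nonneg (hv k)
  have hA : ∀ k ∈ s, 0 ≤ ((ε + M) * (if (1 - η) * t < nn (v k) * x k then 1 else 0)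
        - M * (if (1 + η) * t < nn (v k) * x k then 1 else 0)) := by
    intro k _
    split_ifs with h1 h2 h2
    · linarith
    · linarith
    · exfalso; nlinarith
    · linarith
  have hB : ∀ k ∈ s, ∀ j ∈ s, 0 ≤ (if k ≠ j ∧ δ * t < x k ∧ δ * t < x j then ((s.card : ℝ) + 1) * M else 0) := by
    intro k _ j _
    split_ifs
    · positivity
    · exact le_rfl
  have hA' := Finset.sum_nonneg hA
  have hB' := Finset.sum_nonneg fun k hk => Finset.sum_nonneg (hB k hk)
  by_cases h2 : ∃ k ∈ s, ∃ j ∈ s, k ≠ j ∧ δ * t < x k ∧ δ * t < x j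
  · obtain ⟨k, hk, j, hj, h⟩ := h2
    have h3 : ((s.card : ℝ) + 1) * M ≤ ∑ k ∈ s, ∑ j ∈ s, (if k ≠ j ∧ δ * t < x k ∧ δ * t < x j then ((s.card : ℝ) + 1) * M else 0) := by
      refine le_trans ?_ (Finset.single_le_sum (fun k hk => Finset.sum_nonneg (hB k hk)) hk)
      refine le_trans ?_ (Finset.single_le_sum (hB k hk) hj)
      rw [if_pos h]
    have h4 : |(if t < nn C then f (fun i => C i / nn C) else 0)| ≤ M := by
      split_ifs
      · exact hM _
      · simpa using hM0
    have h5 : |∑ k ∈ s, (if t < nn (v k) * x k then f (fun i => v k i / nn (v k)) else 0)| ≤ s.card * M := by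
      refine (Finset.abs_sum_le_sum_abs _ _).trans ?_
      rw [← nsmul_eq_mul]
      refine Finset.sum_le_card_nsmul _ _ _ fun k _ => ?_
      split_ifs
      · exact hM _
      · simpa using hM0
    have := abs_sub (if t < nn C then f (fun i => C i / nn C) else 0) (∑ k ∈ s, (if t < nn (v k) * x k then f (fun i => v k i / nn (v k)) else 0))
    linarith
  push Not at h2
  have hsmall : ∀ s' : Finset ℕ, s' ⊆ s → (∀ j ∈ s', x j ≤ δ * t) →
      ∑ j ∈ s', nn (v j) * x j ≤ η * t := by
    intro s' hs' hj
    calc ∑ j ∈ s', nn (v j) * x j ≤ ∑ j ∈ s', nn (v j) * (δ * t) :=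
          Finset.sum_le_sum fun j hj' => mul_le_mul_of_nonneg_left (hj j hj') (hb j)
      _ ≤ ∑ j ∈ s, nn (v j) * (δ * t) :=
          Finset.sum_le_sum_of_subset_of_nonneg hs' fun j _ _ => by
            have := hb j; positivity
      _ = (δ * ∑ j ∈ s, nn (v j)) * t := by rw [← Finset.sum_mul]; ring
      _ ≤ η * t := by gcongr
  have hsmall1 : ∀ j ∈ s, x j ≤ δ * t → nn (v j) * x j ≤ η * t := by
    intro j hj h
    simpa using hsmall {j} (by simpa using hj) (by simpa using h)
  have hsumle : ∀ s' : Finset ℕ, nn (∑ k ∈ s', x k • v k) ≤ ∑ k ∈ s', nn (v k) * x k := by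
    intro s'
    refine (H.sum_le s' fun k _ => (hv k).smul (x k)).trans (le_of_eq ?_)
    refine Finset.sum_congr rfl fun k _ => ?_
    rw [H.smul _ _ (hv k).fin, abs_of_nonneg (hx k), mul_comm]
  by_cases h1 : ∃ k ∈ s, δ * t < x k
  swap
  · push Not at h1
    have hC1 : nn C ≤ η * t := by
      rw [hC]; exact (hsumle s).trans (hsmall s subset_rfl h1)
    rw [if_neg (by nlinarith), Finset.sum_eq_zero]
    · simp only [sub_zero, abs_zero]; linarith
    · intro k hk
      have := hsmall1 k hk (h1 k hk)
      rw [if_neg (by nlinarith)]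
  obtain ⟨k, hk, hkx⟩ := h1
  have hj : ∀ j ∈ s, j ≠ k → x j ≤ δ * t := fun j hj' hjk => h2 k hk j hj' hjk.symm hkx
  rw [Finset.sum_eq_single k]
  rotate_left
  · intro j hjs hjk
    have := hsmall1 j hjs (hj j hjs hjk)
    rw [if_neg (by nlinarith)]
  · intro h; exact absurd hk h
  have hA1 := Finset.single_le_sum hA hk
  refine le_trans ?_ (hA1.trans (le_add_of_nonneg_right hB'))
  have hCs : SuppIn n C := by rw [hC]; exact SuppIn.sum fun k _ => (hv k).smul _
  have hdiff : nn (C - x k • v k) ≤ η * t := by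
    have e : C - x k • v k = ∑ j ∈ s.erase k, x j • v j := by
      rw [hC, ← Finset.add_sum_erase s _ hk, add_sub_cancel_left]
    rw [e]
    exact (hsumle _).trans (hsmall _ (Finset.erase_subset _ _) fun j hj' =>
      hj j (Finset.mem_of_mem_erase hj') (Finset.ne_of_mem_erase hj'))
  have hcy := (H.abs_sub_le hCs ((hv k).smul (x k))).trans hdiff
  rw [H.smul _ _ (hv k).fin, abs_of_nonneg (hx k), mul_comm, abs_le] at hcy
  obtain ⟨hc1, hc2⟩ := hcy
  by_cases hc : t < nn C <;> by_cases hy : t < nn (v k) * x k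
  · rw [if_pos hc, if_pos hy, if_pos (by nlinarith)]
    have hxk : 0 < x k := by
      rcases (hx k).eq_or_lt with h | h
      · rw [← h, mul_zero] at hy; linarith
      · exact h
    have hbk : 0 < nn (v k) := by
      rcases (hb k).eq_or_lt with h | h
      · rw [← h, zero_mul] at hy; linarith
      · exact h
    have hd := H.dir hCs (hv k) hxk (ht.trans hc) hbk
    have hd2 : 2 * nn (C - x k • v k) / nn C < ρ := by
      rw [div_lt_iff₀ (ht.trans hc)]
      nlinarith
    have := hf k hk _ (hd.trans_lt hd2)
    refine this.trans ?_
    split_ifs <;> linarith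
  · rw [if_pos hc, if_neg hy, if_pos (by nlinarith), if_neg (by nlinarith)]
    have := hM (fun i => C i / nn C)
    simp only [sub_zero]; linarith
  · rw [if_neg hc, if_pos hy, if_pos (by nlinarith), if_neg (by nlinarith)]
    have := hM (fun i => v k i / nn (v k))
    rw [zero_sub, abs_neg]; linarith
  · rw [if_neg hc, if_neg hy]
    simpa using hA k hk

section
variable {Ω : Type*} [MeasurableSpace Ω] (P : Measure Ω) [IsProbabilityMeasure P]
  (X : ℕ → Ω → ℝ)

lemma tail_eq (hXid : ∀ i, 1 ≤ i → IdentDistrib (X i) (X 1) P P) {k : ℕ} (hk : 1 ≤ k)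
    {c : ℝ} (hc : 0 < c) (x : ℝ) :
    P.real {ω | x < c * X k ω} = P.real {ω | x / c < X 1 ω} := by
  have h := (hXid k hk).measure_mem_eq (measurableSet_Ioi (a := x / c))
  have e : {ω | x < c * X k ω} = X k ⁻¹' Set.Ioi (x / c) := by
    ext ω; simp [div_lt_iff₀ hc, mul_comm]
  rw [e]
  simp only [Measure.real]
  rw [h]; rfl

lemma tail_lim (hXid : ∀ i, 1 ≤ i → IdentDistrib (X i) (X 1) P P) (α : ℝ) (hα : 0 < α)
    (hRV : ∀ t : ℝ, 0 < t →
      Tendsto (fun x => P.real {ω | t * x < X 1 ω} / P.real {ω | x < X 1 ω})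
        atTop (nhds (t ^ (-α)))) {k : ℕ} (hk : 1 ≤ k) {c s : ℝ} (hc : 0 ≤ c) (hs : 0 < s) :
    Tendsto (fun x => P.real {ω | s * x < c * X k ω} / P.real {ω | x < X 1 ω})
        atTop (nhds (c ^ α * s ^ (-α))) := by
  rcases hc.eq_or_lt with h | h
  · rw [← h, Real.zero_rpow hα.ne', zero_mul]
    refine Tendsto.congr' ?_ tendsto_const_nhds
    filter_upwards [eventually_ge_atTop 0] with x hx
    have : {ω | s * x < 0 * X k ω} = ∅ := by
      ext ω; simp; positivity
    rw [this]; simp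
  · have h1 := hRV (s / c) (by positivity)
    have e : (s / c) ^ (-α) = c ^ α * s ^ (-α) := by
      rw [Real.div_rpow hs.le h.le, Real.rpow_neg h.le]; field_simp
    rw [e] at h1
    refine h1.congr fun x => ?_
    rw [tail_eq P X hXid hk h, div_mul_eq_mul_div]

lemma tail_bound (hXid : ∀ i, 1 ≤ i → IdentDistrib (X i) (X 1) P P) (α β : ℝ) (hα : 0 < α)
    (hβ : α < β) (hRVpos : ∀ x : ℝ, 0 < x → 0 < P.real {ω | x < X 1 ω})
    (hRV : ∀ t : ℝ, 0 < t →
      Tendsto (fun x => P.real {ω | t * x < X 1 ω} / P.real {ω | x < X 1 ω})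
        atTop (nhds (t ^ (-α)))) :
    ∃ x₀ K : ℝ, 0 < x₀ ∧ 0 ≤ K ∧ ∀ x ≥ x₀, ∀ c : ℝ, 0 ≤ c → ∀ k, 1 ≤ k →
      P.real {ω | x < c * X k ω} ≤ K * (1 + c ^ β) * P.real {ω | x < X 1 ω} := by
  obtain ⟨x₀, K, h0, hK, h⟩ := potter_real (fun x => P.real {ω | x < X 1 ω})
    (fun x y hxy => measureReal_mono (fun ω (hω : y < X 1 ω) => lt_of_le_of_lt hxy hω)) hRVpos
    (fun x => measureReal_le_one) α β hα hβ (hRV _ (by norm_num))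
  refine ⟨x₀, K, h0, hK, fun x hx c hc k hk => ?_⟩
  rcases hc.eq_or_lt with hc | hc
  · have : {ω | x < c * X k ω} = ∅ := by
      ext ω; simp [← hc]; linarith
    rw [this]; simp only [measureReal_empty]
    have := Real.rpow_nonneg (hc ▸ le_rfl : 0 ≤ c) β
    positivity
  · rw [tail_eq P X hXid hk hc]; exact h x hx c hc

lemma two_big (hRVpos : ∀ x : ℝ, 0 < x → 0 < P.real {ω | x < X 1 ω}) (α : ℝ)
    (hRV : ∀ t : ℝ, 0 < t →
      Tendsto (fun x => P.real {ω | t * x < X 1 ω} / P.real {ω | x < X 1 ω})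
        atTop (nhds (t ^ (-α))))
    (hUAI : ∀ ε : ℝ, 0 < ε → ∃ x₀ : ℝ, ∀ x ≥ x₀, ∀ i j : ℕ, 1 ≤ i → 1 ≤ j → i ≠ j →
      P.real {ω | x < X i ω ∧ x < X j ω} ≤ ε * P.real {ω | x < X 1 ω})
    {i j : ℕ} (hi : 1 ≤ i) (hj : 1 ≤ j) {δ : ℝ} (hδ : 0 < δ) :
    Tendsto (fun x => P.real {ω | i ≠ j ∧ δ * x < X i ω ∧ δ * x < X j ω} / P.real {ω | x < X 1 ω})
        atTop (nhds 0) := by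
  by_cases hij : i = j
  · simp [hij]
  simp only [ne_eq, hij, not_false_eq_true, true_and]
  have h1 : Tendsto (fun x => P.real {ω | x < X i ω ∧ x < X j ω} / P.real {ω | x < X 1 ω})
      atTop (nhds 0) := by
    rw [Metric.tendsto_atTop]
    intro ε hε
    obtain ⟨x₀, h⟩ := hUAI (ε / 2) (by linarith)
    refine ⟨max x₀ 1, fun x hx => ?_⟩
    have hp := hRVpos x (lt_of_lt_of_le one_pos ((le_max_right _ _).trans hx))
    have h3 := h x ((le_max_left _ _).trans hx) i j hi hj hij
    rw [Real.dist_eq, sub_zero, abs_of_nonneg (by positivity), div_lt_iff₀ hp]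
    nlinarith
  have h2 : Tendsto (fun x : ℝ => δ * x) atTop atTop := tendsto_id.const_mul_atTop hδ
  have h3 := (h1.comp h2).mul (hRV δ hδ)
  rw [zero_mul] at h3
  refine h3.congr' ?_
  filter_upwards [eventually_gt_atTop 0] with x hx
  have := hRVpos (δ * x) (by positivity)
  simp only [Function.comp]
  field_simp

end

section
variable {Ω : Type*} [MeasurableSpace Ω] (P : Measure Ω) [IsProbabilityMeasure P]

lemma int_ite (p : Ω → Prop) [DecidablePred p] (hp : MeasurableSet {ω | p ω}) (K : ℝ) :
    (∫ ω, (if p ω then K else 0) ∂P) = K * P.real {ω | p ω} ∧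
    Integrable (fun ω => if p ω then K else 0) P := by
  have e : (fun ω => if p ω then K else 0) = Set.indicator {ω | p ω} (fun _ => K) := by
    funext ω; simp [Set.indicator_apply]
  rw [e]
  constructor
  · rw [integral_indicator_const _ hp, smul_eq_mul, mul_comm]
  · exact (integrable_const K).indicator hp

lemma hmeas {β : Type*} [MeasurableSpace β] {nn : (ℕ → ℝ) → ℝ} (H : IsSN nn) {f : (ℕ → ℝ) → ℝ}
    (hf : NCont nn f) {n : ℕ} {v : β → ℕ → ℝ} (hv : ∀ b, SuppIn n (v b))
    (hm : ∀ i, Measurable fun b => v b i) (x : ℝ) :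
    Measurable fun b => if x < nn (v b) then f (fun i => v b i / nn (v b)) else 0 := by
  have h1 : Measurable fun b => nn (v b) := meas_of_ext (ext_nn_cont H n) hv hm
  refine Measurable.ite (measurableSet_lt measurable_const h1) ?_ measurable_const
  exact meas_of_ext (v := fun b i => v b i / nn (v b)) (ext_f_cont H hf n)
    (fun b i hi => by simp [hv b i hi]) (fun i => (hm i).div h1)

variable (X : ℕ → Ω → ℝ)

lemma det_lim (hXmeas : ∀ i, Measurable (X i)) (hXnonneg : ∀ i ω, 0 ≤ X i ω)
    (hXid : ∀ i, 1 ≤ i → IdentDistrib (X i) (X 1) P P) (α : ℝ) (hα : 0 < α)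
    (hRVpos : ∀ x : ℝ, 0 < x → 0 < P.real {ω | x < X 1 ω})
    (hRV : ∀ t : ℝ, 0 < t →
      Tendsto (fun x => P.real {ω | t * x < X 1 ω} / P.real {ω | x < X 1 ω})
        atTop (nhds (t ^ (-α))))
    (hUAI : ∀ ε : ℝ, 0 < ε → ∃ x₀ : ℝ, ∀ x ≥ x₀, ∀ i j : ℕ, 1 ≤ i → 1 ≤ j → i ≠ j →
      P.real {ω | x < X i ω ∧ x < X j ω} ≤ ε * P.real {ω | x < X 1 ω})
    {nn : (ℕ → ℝ) → ℝ} (H : IsSN nn) (f : (ℕ → ℝ) → ℝ) (M : ℝ)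
    (hM : ∀ u, |f u| ≤ M) (hf : NCont nn f) (a : ℕ → ℕ → ℝ) (n : ℕ)
    (C : Ω → ℕ → ℝ) (hC : ∀ ω, C ω = matVecSeq a n (fun i => X (i + 1) ω)) :
    Tendsto (fun x => (∫ ω, (if x < nn (C ω) then f (fun i => C ω i / nn (C ω)) else 0) ∂P)
        / P.real {ω | x < X 1 ω}) atTop
      (nhds (∑ k ∈ Finset.Icc 1 n, (if nn (colSeq a n k) = 0 then 0 else
            nn (colSeq a n k) ^ α * f (fun i => colSeq a n k i / nn (colSeq a n k))))) := by
  set s := Finset.Icc 1 n with hs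
  set v := colSeq a n with hv
  have hs1 : ∀ k ∈ s, 1 ≤ k := fun k hk => (Finset.mem_Icc.mp hk).1
  have hvs : ∀ k, SuppIn n (v k) := fun k => colSeq_supp a n k
  have hb : ∀ k, 0 ≤ nn (v k) := fun k => H.nonneg (hvs k)
  have hM0 : 0 ≤ M := (abs_nonneg _).trans (hM 0)
  have hC' : ∀ ω, C ω = ∑ k ∈ s, X k ω • v k := fun ω => by
    rw [hC, matVec_eq a n (fun i => X i ω)]
  have hCs : ∀ ω, SuppIn n (C ω) := fun ω => by rw [hC]; exact matVec_supp _ _ _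
  have hCm : ∀ i, Measurable fun ω => C ω i := fun i => by
    simp only [hC', Finset.sum_apply, Pi.smul_apply, smul_eq_mul]
    exact Finset.measurable_fun_sum _ fun k _ => (hXmeas k).mul_const _
  set p : ℝ → ℝ := fun x => P.real {ω | x < X 1 ω} with hp
  set T : ℝ → ℝ := fun x => ∑ k ∈ s, f (fun i => v k i / nn (v k)) *
    (P.real {ω | x < nn (v k) * X k ω} / p x) with hT
  have hTlim : Tendsto T atTop (nhds (∑ k ∈ s, (if nn (v k) = 0 then 0 else
            nn (v k) ^ α * f (fun i => v k i / nn (v k))))) := by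
    refine tendsto_finsetSum _ fun k hk => ?_
    have := tail_lim P X hXid α hα hRV (hs1 k hk) (hb k) one_pos
    simp only [one_mul, Real.one_rpow, mul_one] at this
    have h2 := this.const_mul (f (fun i => v k i / nn (v k)))
    convert h2 using 2
    split_ifs with h0
    · rw [h0, Real.zero_rpow hα.ne', mul_zero]
    · rw [mul_comm]
  set g : ℝ → ℝ := fun x => (∫ ω, (if x < nn (C ω) then f (fun i => C ω i / nn (C ω)) else 0) ∂P)
        / p x with hg
  suffices hgT : Tendsto (fun x => g x - T x) atTop (nhds 0) by
    have := hgT.add hTlim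
    simpa using this
  rw [Metric.tendsto_nhds]
  intro e he
  set B := ∑ k ∈ s, nn (v k) ^ α with hB
  have hB0 : 0 ≤ B := Finset.sum_nonneg fun k _ => Real.rpow_nonneg (hb k) _
  obtain ⟨ε, hε, hεB⟩ : ∃ ε : ℝ, 0 < ε ∧ ε * B < e := by
    refine ⟨e / (B + 1), by positivity, ?_⟩
    rw [div_mul_eq_mul_div, div_lt_iff₀ (by positivity)]; nlinarith
  obtain ⟨ρ, hρ, hfρ⟩ : ∃ ρ : ℝ, 0 < ρ ∧ ∀ k ∈ s, ∀ w : ℕ → ℝ,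
      nn (fun i => w i - v k i / nn (v k)) < ρ → |f w - f (fun i => v k i / nn (v k))| ≤ ε := by
    have h1 : ∀ k, ∃ ρ : ℝ, 0 < ρ ∧ ∀ w : ℕ → ℝ,
      nn (fun i => w i - v k i / nn (v k)) < ρ → |f w - f (fun i => v k i / nn (v k))| < ε :=
      fun k => hf _ ε hε
    choose r hr0 hr using h1
    have h2 : ∀ᶠ ρ in nhdsWithin (0 : ℝ) (Set.Ioi 0), ∀ k ∈ s, ρ < r k := by
      rw [Filter.eventually_all_finset]
      intro k _
      exact nhdsWithin_le_nhds (gt_mem_nhds (hr0 k))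
    obtain ⟨ρ, hρ, hρ0⟩ := (h2.and self_mem_nhdsWithin).exists
    exact ⟨ρ, hρ0, fun k hk w hw => (hr k w (hw.trans (hρ k hk))).le⟩
  obtain ⟨η, hη0, hη1, hηρ, hηr⟩ : ∃ η : ℝ, 0 < η ∧ η < 1 ∧ 2 * η < ρ ∧
      (∑ k ∈ s, ((ε + M) * (nn (v k) ^ α * (1 - η) ^ (-α))
        - M * (nn (v k) ^ α * (1 + η) ^ (-α)))) < e := by
    have hcont : ContinuousAt (fun η : ℝ => ∑ k ∈ s, ((ε + M) * (nn (v k) ^ α * (1 - η) ^ (-α))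
        - M * (nn (v k) ^ α * (1 + η) ^ (-α)))) 0 := by
      have c1 : ContinuousAt (fun η : ℝ => (1 - η) ^ (-α)) 0 :=
        (continuousAt_const.sub continuousAt_id).rpow_const (Or.inl (by simp))
      have c2 : ContinuousAt (fun η : ℝ => (1 + η) ^ (-α)) 0 :=
        (continuousAt_const.add continuousAt_id).rpow_const (Or.inl (by simp))
      refine tendsto_finsetSum _ fun k _ => ?_
      exact (continuousAt_const.mul (continuousAt_const.mul c1)).sub
        (continuousAt_const.mul (continuousAt_const.mul c2))
    have hv0 : (∑ k ∈ s, ((ε + M) * (nn (v k) ^ α * (1 - (0 : ℝ)) ^ (-α))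
        - M * (nn (v k) ^ α * (1 + (0 : ℝ)) ^ (-α)))) < e := by
      simp only [sub_zero, add_zero, Real.one_rpow, mul_one]
      refine lt_of_eq_of_lt ?_ hεB
      rw [hB, Finset.mul_sum]
      exact Finset.sum_congr rfl fun k _ => by ring
    have h1 := hcont.eventually (gt_mem_nhds hv0)
    have h2 : ∀ᶠ η in nhds (0 : ℝ), η < 1 := gt_mem_nhds one_pos
    have h3 : ∀ᶠ η in nhds (0 : ℝ), η < ρ / 2 := gt_mem_nhds (by positivity)
    have h4 : ∀ᶠ η in nhdsWithin (0 : ℝ) (Set.Ioi 0), _ :=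
      nhdsWithin_le_nhds (h1.and (h2.and h3))
    obtain ⟨η, ⟨h1, h2, h3⟩, h0⟩ := (h4.and self_mem_nhdsWithin).exists
    exact ⟨η, h0, h2, by linarith, h1⟩
  set D := ∑ k ∈ s, nn (v k) with hD
  have hD0 : 0 ≤ D := Finset.sum_nonneg fun k _ => hb k
  set δ := η / (D + 1) with hδ
  have hδ0 : 0 < δ := by positivity
  have hδη : δ * D ≤ η := by
    rw [hδ, div_mul_eq_mul_div, div_le_iff₀ (by positivity)]; nlinarith
  set R : ℝ → ℝ := fun x => ∑ k ∈ s, ((ε + M) * (P.real {ω | (1 - η) * x < nn (v k) * X k ω} / p x)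
        - M * (P.real {ω | (1 + η) * x < nn (v k) * X k ω} / p x))
    + ∑ k ∈ s, ∑ j ∈ s, ((s.card : ℝ) + 1) * M *
      (P.real {ω | k ≠ j ∧ δ * x < X k ω ∧ δ * x < X j ω} / p x) with hR
  have hRlim : Tendsto R atTop (nhds ((∑ k ∈ s, ((ε + M) * (nn (v k) ^ α * (1 - η) ^ (-α))
        - M * (nn (v k) ^ α * (1 + η) ^ (-α)))) + ∑ k ∈ s, ∑ j ∈ s, ((s.card : ℝ) + 1) * M * 0)) := by
    refine Tendsto.add (tendsto_finsetSum _ fun k hk => ?_) (tendsto_finsetSum _ fun k hk =>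
      tendsto_finsetSum _ fun j hj => ?_)
    · exact ((tail_lim P X hXid α hα hRV (hs1 k hk) (hb k) (by linarith)).const_mul _).sub
        ((tail_lim P X hXid α hα hRV (hs1 k hk) (hb k) (by linarith)).const_mul _)
    · exact (two_big P X hRVpos α hRV hUAI (hs1 k hk) (hs1 j hj) hδ0).const_mul _
  have hRe := hRlim.eventually (gt_mem_nhds (by simpa using hηr : _ < e))
  filter_upwards [hRe, eventually_gt_atTop 0] with x hxR hx0
  rw [Real.dist_eq, sub_zero]
  refine lt_of_le_of_lt ?_ hxR
  have hpx : 0 < p x := hRVpos x hx0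
  have m1 : ∀ k t, MeasurableSet {ω | t < nn (v k) * X k ω} := fun k t =>
    measurableSet_lt measurable_const ((hXmeas k).const_mul _)
  have m2 : ∀ k t, MeasurableSet {ω | t < X k ω} := fun k t =>
    measurableSet_lt measurable_const (hXmeas k)
  have m3 : ∀ (k j : ℕ) t, MeasurableSet {ω | k ≠ j ∧ t < X k ω ∧ t < X j ω} := fun k j t =>
    (MeasurableSet.const _).inter ((m2 k t).inter (m2 j t))
  have iA : Integrable (fun ω => if x < nn (C ω) then f (fun i => C ω i / nn (C ω)) else 0) P := by
    refine Integrable.of_bound (hmeas H hf hCs hCm x).aestronglyMeasurable M (ae_of_all _ fun ω => ?_)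
    split_ifs
    · exact hM _
    · simpa using hM0
  have iS : Integrable (fun ω => ∑ k ∈ s,
      (if x < nn (v k) * X k ω then f (fun i => v k i / nn (v k)) else 0)) P :=
    integrable_finsetSum _ fun k _ => (int_ite P _ (m1 k x) _).2
  have eS : (∫ ω, ∑ k ∈ s,
      (if x < nn (v k) * X k ω then f (fun i => v k i / nn (v k)) else 0) ∂P) = T x * p x := by
    rw [integral_finsetSum _ fun k _ => (int_ite P _ (m1 k x) _).2, hT, Finset.sum_mul]
    refine Finset.sum_congr rfl fun k _ => ?_
    rw [(int_ite P _ (m1 k x) _).1]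
    field_simp
  have i1 : ∀ k ∈ s, Integrable (fun ω => (ε + M) * (if (1 - η) * x < nn (v k) * X k ω then (1 : ℝ) else 0)
        - M * (if (1 + η) * x < nn (v k) * X k ω then (1 : ℝ) else 0)) P := fun k _ =>
    ((int_ite P _ (m1 k _) 1).2.const_mul _).sub ((int_ite P _ (m1 k _) 1).2.const_mul _)
  have i2 : ∀ k ∈ s, ∀ j ∈ s, Integrable (fun ω => (if k ≠ j ∧ δ * x < X k ω ∧ δ * x < X j ω then
      ((s.card : ℝ) + 1) * M else 0)) P := fun k _ j _ => (int_ite P _ (m3 k j _) _).2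
  have i2' : ∀ k ∈ s, Integrable (fun ω => ∑ j ∈ s,
      (if k ≠ j ∧ δ * x < X k ω ∧ δ * x < X j ω then
      ((s.card : ℝ) + 1) * M else 0)) P := fun k hk => integrable_finsetSum _ (i2 k hk)
  have eR : (∫ ω, (∑ k ∈ s, ((ε + M) * (if (1 - η) * x < nn (v k) * X k ω then (1 : ℝ) else 0)
        - M * (if (1 + η) * x < nn (v k) * X k ω then (1 : ℝ) else 0))
      + ∑ k ∈ s, ∑ j ∈ s, (if k ≠ j ∧ δ * x < X k ω ∧ δ * x < X j ω then
      ((s.card : ℝ) + 1) * M else 0)) ∂P) = R x * p x := by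
    rw [integral_add (integrable_finsetSum _ i1) (integrable_finsetSum _ i2'),
      integral_finsetSum _ i1, integral_finsetSum _ i2']
    change _ = (_ + _) * p x
    rw [add_mul _ _ (p x), Finset.sum_mul, Finset.sum_mul]
    congr 1
    · refine Finset.sum_congr rfl fun k _ => ?_
      rw [integral_sub ((int_ite P _ (m1 k _) 1).2.const_mul _)
        ((int_ite P _ (m1 k _) 1).2.const_mul _), integral_const_mul, integral_const_mul,
        (int_ite P _ (m1 k _) 1).1, (int_ite P _ (m1 k _) 1).1]
      field_simp
    · refine Finset.sum_congr rfl fun k hk => ?_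
      rw [integral_finsetSum _ (i2 k hk), Finset.sum_mul]
      refine Finset.sum_congr rfl fun j _ => ?_
      rw [(int_ite P _ (m3 k j _) _).1]
      field_simp
  have key : |(∫ ω, (if x < nn (C ω) then f (fun i => C ω i / nn (C ω)) else 0) ∂P) - T x * p x|
      ≤ R x * p x := by
    rw [← eS, ← eR, ← integral_sub iA iS]
    refine (abs_integral_le_integral_abs).trans ?_
    refine integral_mono (iA.sub iS).abs
      ((integrable_finsetSum _ i1).add (integrable_finsetSum _ i2')) fun ω => ?_
    exact pointwise_bound H f M hM n s v hvs (fun k => X k ω) (fun k => hXnonneg k ω) δ η ε ρ x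
      hx0 hδ0 hη1 hε.le hδη hη0 hηρ hfρ (C ω) (hC' ω)
  have e3 : g x - T x = ((∫ ω, (if x < nn (C ω) then f (fun i => C ω i / nn (C ω)) else 0) ∂P)
      - T x * p x) / p x := by rw [hg]; field_simp
  rw [e3, abs_div, abs_of_pos hpx, div_le_iff₀ hpx]
  exact key

lemma det_bound (hXmeas : ∀ i, Measurable (X i)) (hXnonneg : ∀ i ω, 0 ≤ X i ω)
    {nn : (ℕ → ℝ) → ℝ} (H : IsSN nn) (f : (ℕ → ℝ) → ℝ) (M : ℝ)
    (hM : ∀ u, |f u| ≤ M) (a : ℕ → ℕ → ℝ) (n : ℕ)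
    (C : Ω → ℕ → ℝ) (hC : ∀ ω, C ω = matVecSeq a n (fun i => X (i + 1) ω)) (x : ℝ) (hx : 0 < x) :
    |∫ ω, (if x < nn (C ω) then f (fun i => C ω i / nn (C ω)) else 0) ∂P| ≤
      M * ∑ k ∈ Finset.Icc 1 n, P.real {ω | x < (n * nn (colSeq a n k)) * X k ω} := by
  have hM0 : 0 ≤ M := (abs_nonneg _).trans (hM 0)
  have m1 : ∀ k t, MeasurableSet {ω | t < (n * nn (colSeq a n k)) * X k ω} := fun k t =>
    measurableSet_lt measurable_const ((hXmeas k).const_mul _)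
  have e : M * ∑ k ∈ Finset.Icc 1 n, P.real {ω | x < (n * nn (colSeq a n k)) * X k ω}
      = ∫ ω, ∑ k ∈ Finset.Icc 1 n, (if x < (n * nn (colSeq a n k)) * X k ω then M else 0) ∂P := by
    rw [integral_finsetSum _ fun k _ => (int_ite P _ (m1 k x) _).2, Finset.mul_sum]
    exact Finset.sum_congr rfl fun k _ => (int_ite P _ (m1 k x) _).1.symm
  rw [e, ← Real.norm_eq_abs]
  refine norm_integral_le_of_norm_le (integrable_finsetSum _ fun k _ => (int_ite P _ (m1 k x) _).2)
    (ae_of_all _ fun ω => ?_)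
  have hnn : ∀ k ∈ Finset.Icc 1 n, 0 ≤ (if x < (n * nn (colSeq a n k)) * X k ω then M else 0) := by
    intro k _; split_ifs <;> simp [hM0]
  split_ifs with h
  · refine (hM _).trans ?_
    obtain ⟨k, hk, hkx⟩ : ∃ k ∈ Finset.Icc 1 n, x < (n * nn (colSeq a n k)) * X k ω := by
      by_contra hcon
      push Not at hcon
      rw [hC, matVec_eq a n (fun i => X i ω)] at h
      have h1 := H.sum_le (Finset.Icc 1 n) fun k _ => (colSeq_supp a n k).smul (X k ω)
      have h2 : ∀ k ∈ Finset.Icc 1 n, n * nn (X k ω • colSeq a n k) ≤ x := fun k hk => by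
        rw [H.smul _ _ (colSeq_supp a n k).fin, abs_of_nonneg (hXnonneg k ω)]
        linarith [hcon k hk]
      have h3 := Finset.sum_le_card_nsmul _ _ _ h2
      rw [← Finset.mul_sum, Nat.card_Icc, nsmul_eq_mul, Nat.add_sub_cancel] at h3
      rcases Nat.eq_zero_or_pos n with h0 | h0
      · simp only [h0, Finset.Icc_eq_empty (by norm_num : ¬ 1 ≤ 0), Finset.sum_empty] at h
        rw [H.zero] at h
        linarith
      · have := le_of_mul_le_mul_left h3 (by exact_mod_cast h0)
        linarith
    refine le_trans ?_ (Finset.single_le_sum hnn hk)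
    rw [if_pos hkx]
  · simpa using Finset.sum_nonneg hnn

end

lemma meas_N {Ω β : Type*} [MeasurableSpace Ω] [MeasurableSpace β] {N : Ω → ℕ} (hN : Measurable N)
    {F : ℕ → Ω → β} (hF : ∀ n, Measurable (F n)) : Measurable fun ω => F (N ω) ω := by
  have h : Measurable (fun q : ℕ × Ω => F q.1 q.2) := measurable_from_prod_countable_right hF
  exact h.comp (hN.prodMk measurable_id)

lemma core {Ω : Type*} [MeasurableSpace Ω] (P : Measure Ω) [IsProbabilityMeasure P]
    (X : ℕ → Ω → ℝ) (hXmeas : ∀ i, Measurable (X i))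
    (hXnonneg : ∀ i ω, 0 ≤ X i ω)
    (hXid : ∀ i, 1 ≤ i → IdentDistrib (X i) (X 1) P P)
    (α : ℝ) (hα : 0 < α)
    (hRVpos : ∀ x : ℝ, 0 < x → 0 < P.real {ω | x < X 1 ω})
    (hRV : ∀ t : ℝ, 0 < t →
      Tendsto (fun x => P.real {ω | t * x < X 1 ω} / P.real {ω | x < X 1 ω})
        atTop (nhds (t ^ (-α))))
    (hUAI : ∀ ε : ℝ, 0 < ε → ∃ x₀ : ℝ, ∀ x ≥ x₀, ∀ i j : ℕ, 1 ≤ i → 1 ≤ j → i ≠ j →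
      P.real {ω | x < X i ω ∧ x < X j ω} ≤ ε * P.real {ω | x < X 1 ω})
    (a : ℕ → ℕ → Ω → ℝ) (hameas : ∀ i j, Measurable fun ω => a i j ω)
    (haX_indep : IndepFun (fun ω => fun q : ℕ × ℕ => a q.1 q.2 ω)
      (fun ω => fun i : ℕ => X i ω) P)
    (N : Ω → ℕ) (hNmeas : Measurable N) (hNpos : ∀ ω, 1 ≤ N ω)
    (hN_indep : IndepFun N
      (fun ω => (fun i : ℕ => X i ω, fun q : ℕ × ℕ => a q.1 q.2 ω)) P)
    (hNmom : ∃ ε : ℝ, 0 < ε ∧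
      ∫⁻ ω, ENNReal.ofReal ((N ω : ℝ) ^ ((2 : ℝ) + α + ε)) ∂P < ⊤)
    (nn : (ℕ → ℝ) → ℝ) (H : IsSN nn)
    (hAmom : ∃ ε : ℝ, 0 < ε ∧
      ∫⁻ ω, ENNReal.ofReal (seqOpNorm nn (fun i j => a i j ω) (N ω) ^ (α + ε)
        * (N ω : ℝ) ^ ((1 : ℝ) + α + ε)) ∂P < ⊤)
    (f : (ℕ → ℝ) → ℝ)
    (hf_bdd : ∃ M : ℝ, ∀ u, |f u| ≤ M) (hf : NCont nn f) :
    Tendsto (fun x =>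
        (∫ ω, (if x < nn (matVecSeq (fun i j => a i j ω) (N ω) (fun i => X (i + 1) ω)) then
            f (fun i =>
              matVecSeq (fun i' j => a i' j ω) (N ω) (fun i' => X (i' + 1) ω) i
                / nn (matVecSeq (fun i' j => a i' j ω) (N ω) (fun i' => X (i' + 1) ω)))
          else 0) ∂P)
          / P.real {ω | x < X 1 ω})
      atTop
      (nhds (∫ ω, ∑ k ∈ Finset.Icc 1 (N ω),
          (if nn (colSeq (fun i j => a i j ω) (N ω) k) = 0 then 0 else
            nn (colSeq (fun i j => a i j ω) (N ω) k) ^ α *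
              f (fun i => colSeq (fun i' j => a i' j ω) (N ω) k i
                / nn (colSeq (fun i' j => a i' j ω) (N ω) k))) ∂P)) := by
  obtain ⟨M, hM⟩ := hf_bdd
  have hM0 : 0 ≤ M := (abs_nonneg _).trans (hM 0)
  obtain ⟨ε₁, hε₁, hN1⟩ := hNmom
  obtain ⟨ε₂, hε₂, hA1⟩ := hAmom
  set β := α + ε₂ with hβ
  have hβ0 : 0 < β := by linarith
  obtain ⟨x₀, K, hx₀, hK, hpot⟩ := tail_bound P X hXid α β hα (by linarith) hRVpos hRV
  -- the kernel function
  set V : (ℕ × (ℕ × ℕ → ℝ)) × (ℕ → ℝ) → ℕ → ℝ := fun z =>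
    matVecSeq (fun i j => z.1.2 (i, j)) z.1.1 (fun i => z.2 (i + 1)) with hV
  set g : ℝ → (ℕ × (ℕ × ℕ → ℝ)) × (ℕ → ℝ) → ℝ := fun x z =>
    if x < nn (V z) then f (fun i => V z i / nn (V z)) else 0 with hg
  have hgm : ∀ x, Measurable (g x) := by
    intro x
    have h1 : Measurable (fun q : ℕ × ((ℕ × ℕ → ℝ) × (ℕ → ℝ)) => g x ((q.1, q.2.1), q.2.2)) := by
      refine measurable_from_prod_countable_right fun n => ?_
      refine hmeas H hf (n := n) (v := fun q : (ℕ × ℕ → ℝ) × (ℕ → ℝ) => V ((n, q.1), q.2))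
        (fun q => matVec_supp _ _ _) (fun i => ?_) x
      simp only [hV, matVecSeq]
      split_ifs
      · refine Finset.measurable_fun_sum _ fun j _ => ?_
        exact ((measurable_pi_apply _).comp measurable_fst).mul
          ((measurable_pi_apply _).comp measurable_snd)
      · exact measurable_const
    exact h1.comp (f := fun z : (ℕ × (ℕ × ℕ → ℝ)) × (ℕ → ℝ) => (z.1.1, (z.1.2, z.2)))
      (by fun_prop)
  have hgM : ∀ x z, |g x z| ≤ M := by
    intro x z
    simp only [hg]
    split_ifs
    · exact hM _
    · simpa using hM0
  have mA : Measurable (fun ω => fun q : ℕ × ℕ => a q.1 q.2 ω) :=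
    measurable_pi_lambda _ fun q => hameas q.1 q.2
  have mX : Measurable (fun ω => fun i : ℕ => X i ω) := measurable_pi_lambda _ hXmeas
  have hind := indep_assoc P hNmeas mA mX haX_indep hN_indep
  have hfub := fun x => integral_indep P (hNmeas.prodMk mA) mX hind (g x) (hgm x) M (hgM x)
  have hbn : ∀ ω k, 0 ≤ nn (colSeq (fun i j => a i j ω) (N ω) k) := fun ω k =>
    H.nonneg (colSeq_supp _ _ _)
  set bound : Ω → ℝ := fun ω => M * K * ∑ k ∈ Finset.Icc 1 (N ω),
    (1 + ((N ω : ℝ) * nn (colSeq (fun i j => a i j ω) (N ω) k)) ^ β) with hbound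
  have hbm : Measurable bound := by
    refine Measurable.const_mul ?_ _
    refine meas_N hNmeas (F := fun n ω => ∑ k ∈ Finset.Icc 1 n,
      (1 + ((n : ℝ) * nn (colSeq (fun i j => a i j ω) n k)) ^ β)) fun n => ?_
    refine Finset.measurable_fun_sum _ fun k _ => ?_
    have : Measurable fun ω => nn (colSeq (fun i j => a i j ω) n k) := by
      refine meas_of_ext (ext_nn_cont H n) (fun ω => colSeq_supp _ _ _) fun i => ?_
      simp only [colSeq]
      split_ifs
      · exact hameas _ _
      · exact measurable_const
    exact ((this.const_mul _).pow_const _).const_add _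
  have hb0 : ∀ ω, 0 ≤ bound ω := fun ω => by
    refine mul_nonneg (mul_nonneg hM0 hK) (Finset.sum_nonneg fun k _ => ?_)
    have := Real.rpow_nonneg (mul_nonneg (Nat.cast_nonneg (N ω)) (hbn ω k)) β
    linarith
  have hble : ∀ ω, bound ω ≤ M * K * ((N ω : ℝ) ^ ((2 : ℝ) + α + ε₁) +
      seqOpNorm nn (fun i j => a i j ω) (N ω) ^ β * (N ω : ℝ) ^ ((1 : ℝ) + α + ε₂)) := by
    intro ω
    refine mul_le_mul_of_nonneg_left ?_ (mul_nonneg hM0 hK)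
    have hN1' : (1 : ℝ) ≤ N ω := by exact_mod_cast hNpos ω
    have hN0 : (0 : ℝ) < N ω := by linarith
    rw [Finset.sum_add_distrib]
    refine add_le_add ?_ ?_
    · simp only [Finset.sum_const, Nat.card_Icc, Nat.add_sub_cancel, nsmul_eq_mul, mul_one]
      calc (N ω : ℝ) = (N ω : ℝ) ^ (1 : ℝ) := (Real.rpow_one _).symm
        _ ≤ _ := Real.rpow_le_rpow_of_exponent_le hN1' (by linarith)
    · have h1 : ∀ k ∈ Finset.Icc 1 (N ω), ((N ω : ℝ) * nn (colSeq (fun i j => a i j ω) (N ω) k)) ^ β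
          ≤ ((N ω : ℝ) * seqOpNorm nn (fun i j => a i j ω) (N ω)) ^ β := fun k hk =>
        Real.rpow_le_rpow (mul_nonneg hN0.le (hbn ω k))
          (mul_le_mul_of_nonneg_left (col_le_op H _ _ _ hk) hN0.le) hβ0.le
      have h2 := Finset.sum_le_card_nsmul _ _ _ h1
      refine h2.trans (le_of_eq ?_)
      have hop : 0 ≤ seqOpNorm nn (fun i j => a i j ω) (N ω) :=
        (hbn ω 1).trans (col_le_op H _ _ _ (Finset.mem_Icc.mpr ⟨le_rfl, hNpos ω⟩))
      rw [Nat.card_Icc, Nat.add_sub_cancel, nsmul_eq_mul, Real.mul_rpow hN0.le hop,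
        show (1 : ℝ) + α + ε₂ = 1 + β by rw [hβ]; ring, Real.rpow_add hN0 1 β, Real.rpow_one]
      ring
  have hbi : Integrable bound P := by
    refine ⟨hbm.aestronglyMeasurable, ?_⟩
    rw [hasFiniteIntegral_iff_ofReal (ae_of_all _ hb0)]
    refine lt_of_le_of_lt (lintegral_mono fun ω => ENNReal.ofReal_le_ofReal (hble ω)) ?_
    simp_rw [ENNReal.ofReal_mul (mul_nonneg hM0 hK)]
    rw [lintegral_const_mul' _ _ ENNReal.ofReal_ne_top]
    refine ENNReal.mul_lt_top ENNReal.ofReal_lt_top ?_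
    refine lt_of_le_of_lt (lintegral_mono fun ω => ENNReal.ofReal_add_le) ?_
    rw [lintegral_add_left]
    · exact ENNReal.add_lt_top.mpr ⟨hN1, hA1⟩
    · exact ((measurable_from_nat (f := fun n : ℕ => (n : ℝ))).comp hNmeas).pow_const _
        |>.ennreal_ofReal
  have hdct := tendsto_integral_filter_of_dominated_convergence (μ := P) (l := atTop)
    (F := fun (x : ℝ) ω => (∫ ω', g x ((N ω, fun q : ℕ × ℕ => a q.1 q.2 ω), fun i => X i ω') ∂P)
      / P.real {ω | x < X 1 ω})
    (f := fun ω => ∑ k ∈ Finset.Icc 1 (N ω),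
          (if nn (colSeq (fun i j => a i j ω) (N ω) k) = 0 then 0 else
            nn (colSeq (fun i j => a i j ω) (N ω) k) ^ α *
              f (fun i => colSeq (fun i' j => a i' j ω) (N ω) k i
                / nn (colSeq (fun i' j => a i' j ω) (N ω) k)))) bound
    (Eventually.of_forall fun x => ((hfub x).2.div_const _).aestronglyMeasurable)
    (by
      filter_upwards [eventually_ge_atTop x₀] with x hx
      refine ae_of_all _ fun ω => ?_
      have hp := hRVpos x (hx₀.trans_le hx)
      rw [norm_div, Real.norm_eq_abs, Real.norm_eq_abs, abs_of_pos hp, div_le_iff₀ hp]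
      refine (det_bound P X hXmeas hXnonneg H f M hM (fun i j => a i j ω) (N ω)
        (fun ω' => V ((N ω, fun q : ℕ × ℕ => a q.1 q.2 ω), fun i => X i ω')) (fun _ => rfl) x
        (hx₀.trans_le hx)).trans ?_
      rw [hbound]
      simp only
      rw [mul_assoc M K, mul_assoc M]
      refine mul_le_mul_of_nonneg_left ?_ hM0
      rw [mul_assoc, Finset.sum_mul, Finset.mul_sum]
      refine Finset.sum_le_sum fun k hk => ?_
      rw [← mul_assoc]
      exact hpot x hx _ (mul_nonneg (Nat.cast_nonneg _) (hbn ω k)) k (Finset.mem_Icc.mp hk).1)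
    hbi
    (ae_of_all _ fun ω => det_lim P X hXmeas hXnonneg hXid α hα hRVpos hRV hUAI H f M hM hf
      (fun i j => a i j ω) (N ω)
      (fun ω' => V ((N ω, fun q : ℕ × ℕ => a q.1 q.2 ω), fun i => X i ω')) (fun _ => rfl))
  refine hdct.congr fun x => ?_
  rw [integral_div, ← (hfub x).1]

/-- Spectral measure of `C(N) = A(N) X(N)`: for every bounded function `f`,
continuous with respect to the norm `nn`,
`E[f(C(N)/nn(C(N))) 1_{nn(C(N)) > x}] / P(nn(C(N)) > x)` converges, as `x → ∞`, to
`E[∑_{k=1}^N nn(A_k(N))^α f(A_k(N)/nn(A_k(N)))] / E[∑_{k=1}^N nn(A_k(N))^α]`, summands with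
`A_k(N) = 0` being interpreted as `0`. -/
theorem random_length_spectral_measure_of_product
    {Ω : Type*} [MeasurableSpace Ω] (P : Measure Ω) [IsProbabilityMeasure P]
    (X : ℕ → Ω → ℝ) (hXmeas : ∀ i, Measurable (X i))
    (hXnonneg : ∀ i ω, 0 ≤ X i ω)
    (hXid : ∀ i, 1 ≤ i → IdentDistrib (X i) (X 1) P P)
    (α : ℝ) (hα : 0 < α)
    (hRVpos : ∀ x : ℝ, 0 < x → 0 < P {ω | x < X 1 ω})
    (hRV : ∀ t : ℝ, 0 < t →
      Tendsto (fun x => (P {ω | t * x < X 1 ω}).toReal / (P {ω | x < X 1 ω}).toReal)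
        atTop (nhds (t ^ (-α))))
    (hUAI : ∀ ε : ℝ, 0 < ε → ∃ x₀ : ℝ, ∀ x ≥ x₀, ∀ i j : ℕ, 1 ≤ i → 1 ≤ j → i ≠ j →
      (P {ω | x < X i ω ∧ x < X j ω}).toReal ≤ ε * (P {ω | x < X 1 ω}).toReal)
    (a : ℕ → ℕ → Ω → ℝ) (hameas : ∀ i j, Measurable fun ω => a i j ω)
    (hanonneg : ∀ i j ω, 0 ≤ a i j ω)
    (haX_indep : IndepFun (fun ω => fun q : ℕ × ℕ => a q.1 q.2 ω)
      (fun ω => fun i : ℕ => X i ω) P)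
    (N : Ω → ℕ) (hNmeas : Measurable N) (hNpos : ∀ ω, 1 ≤ N ω)
    (hN_indep : IndepFun N
      (fun ω => (fun i : ℕ => X i ω, fun q : ℕ × ℕ => a q.1 q.2 ω)) P)
    (hNmom : ∃ ε : ℝ, 0 < ε ∧
      ∫⁻ ω, ENNReal.ofReal ((N ω : ℝ) ^ ((2 : ℝ) + α + ε)) ∂P < ⊤)
    (nn : (ℕ → ℝ) → ℝ)
    (hnn_tri : ∀ u v : ℕ → ℝ, (Function.support u).Finite → (Function.support v).Finite →
      nn (u + v) ≤ nn u + nn v)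
    (hnn_smul : ∀ (c : ℝ) (u : ℕ → ℝ), (Function.support u).Finite →
      nn (c • u) = |c| * nn u)
    (hnn_zero : ∀ u : ℕ → ℝ, (Function.support u).Finite → nn u = 0 → u = 0)
    (hnn_lower : ∀ u : ℕ → ℝ, (Function.support u).Finite → ∀ i, |u i| ≤ nn u)
    (hnn_upper : ∀ u : ℕ → ℝ, (Function.support u).Finite → nn u ≤ ∑' i, |u i|)
    (hAmom : ∃ ε : ℝ, 0 < ε ∧
      ∫⁻ ω, ENNReal.ofReal (seqOpNorm nn (fun i j => a i j ω) (N ω) ^ (α + ε)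
        * (N ω : ℝ) ^ ((1 : ℝ) + α + ε)) ∂P < ⊤)
    (hpos : 0 < ∫ ω, ∑ k ∈ Finset.Icc 1 (N ω),
      nn (colSeq (fun i j => a i j ω) (N ω) k) ^ α ∂P)
    (f : (ℕ → ℝ) → ℝ)
    (hf_bdd : ∃ M : ℝ, ∀ u, |f u| ≤ M)
    (hf_cont : ∀ u : ℕ → ℝ, ∀ ε : ℝ, 0 < ε → ∃ δ : ℝ, 0 < δ ∧
      ∀ v : ℕ → ℝ, nn (fun i => v i - u i) < δ → |f v - f u| < ε) :
    Tendsto (fun x =>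
        (∫ ω, (if x < nn (matVecSeq (fun i j => a i j ω) (N ω) (fun i => X (i + 1) ω)) then
            f (fun i =>
              matVecSeq (fun i' j => a i' j ω) (N ω) (fun i' => X (i' + 1) ω) i
                / nn (matVecSeq (fun i' j => a i' j ω) (N ω) (fun i' => X (i' + 1) ω)))
          else 0) ∂P)
          / (P {ω | x < nn (matVecSeq (fun i j => a i j ω) (N ω)
              (fun i => X (i + 1) ω))}).toReal)
      atTop
      (nhds ((∫ ω, ∑ k ∈ Finset.Icc 1 (N ω),
          (if nn (colSeq (fun i j => a i j ω) (N ω) k) = 0 then 0 else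
            nn (colSeq (fun i j => a i j ω) (N ω) k) ^ α *
              f (fun i => colSeq (fun i' j => a i' j ω) (N ω) k i
                / nn (colSeq (fun i' j => a i' j ω) (N ω) k))) ∂P)
        / (∫ ω, ∑ k ∈ Finset.Icc 1 (N ω),
            nn (colSeq (fun i j => a i j ω) (N ω) k) ^ α ∂P))) := by
  have H : IsSN nn := ⟨hnn_tri, hnn_smul, hnn_lower, hnn_upper⟩
  have hRVpos' : ∀ x : ℝ, 0 < x → 0 < P.real {ω | x < X 1 ω} := fun x hx =>
    ENNReal.toReal_pos (hRVpos x hx).ne' (measure_ne_top _ _)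
  have h1 := core P X hXmeas hXnonneg hXid α hα hRVpos' hRV hUAI a hameas haX_indep N hNmeas hNpos
    hN_indep hNmom nn H hAmom f hf_bdd hf_cont
  have h2 := core P X hXmeas hXnonneg hXid α hα hRVpos' hRV hUAI a hameas haX_indep N hNmeas hNpos
    hN_indep hNmom nn H hAmom (fun _ => 1) ⟨1, fun _ => by simp⟩
    (fun u ε hε => ⟨1, one_pos, fun v _ => by simpa using hε⟩)
  have e2 : (fun ω => ∑ k ∈ Finset.Icc 1 (N ω),
      (if nn (colSeq (fun i j => a i j ω) (N ω) k) = 0 then 0 else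
            nn (colSeq (fun i j => a i j ω) (N ω) k) ^ α * (1 : ℝ))) =
      (fun ω => ∑ k ∈ Finset.Icc 1 (N ω), nn (colSeq (fun i j => a i j ω) (N ω) k) ^ α) := by
    funext ω
    refine Finset.sum_congr rfl fun k _ => ?_
    split_ifs with h
    · rw [h, Real.zero_rpow hα.ne']
    · rw [mul_one]
  rw [e2] at h2
  have hCm : Measurable fun ω => nn (matVecSeq (fun i j => a i j ω) (N ω)
      (fun i => X (i + 1) ω)) := by
    refine meas_N hNmeas (F := fun n ω => nn (matVecSeq (fun i j => a i j ω) n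
      (fun i => X (i + 1) ω))) fun n => ?_
    refine meas_of_ext (ext_nn_cont H n) (fun ω => matVec_supp _ _ _) fun i => ?_
    simp only [matVecSeq]
    split_ifs
    · exact Finset.measurable_fun_sum _ fun j _ => (hameas _ _).mul (hXmeas _)
    · exact measurable_const
  have h3 := h1.div h2 hpos.ne'
  refine h3.congr' ?_
  filter_upwards [eventually_gt_atTop 0] with x hx
  have hp := hRVpos' x hx
  simp only [Pi.div_apply]
  rw [(int_ite P _ (measurableSet_lt measurable_const hCm) 1).1, one_mul,
    div_div_div_cancel_right₀ hp.ne']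
  rfl
end
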